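/- (Intermediate inequality (7.2) in the proof of Theorem 7.3.) Let 1 ≤ p ≤ n and let A₁, …, A_{p−1}, H, L₁, …, L_{n−p} be nonempty compact convex sets in ℝⁿ. Then MV(A₁, …, A_{p−1}, H, L₁, …, L_{n−p})^{p−1} ≥ Π_{i=1}^{p−1} MV(A_i^{(p−1)}, H, L₁, …, L_{n−p}). -/

import Mathlib

open scoped Pointwise
open MeasureTheory Finset

/-- Lebesgue volume of a subset of ℝⁿ, as a real number. -/
noncomputable def vol {n : ℕ} (A : Set (Fin n → ℝ)) : ℝ := (volume A).toReal

/-- The mixed volume of `n` convex bodies in ℝⁿ, defined by the inclusion–exclusion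
formula. -/
noncomputable def MV (n : ℕ) (K : Fin n → Set (Fin n → ℝ)) : ℝ :=
  ∑ j ∈ Finset.Icc 1 n, (-1 : ℝ) ^ (n - j) *
    ∑ S ∈ Finset.univ.powersetCard j, vol (∑ i ∈ S, K i)

/-- The family `(A₁, …, A_{p−1}, H, L₁, …, L_{n−p})` of `n` sets. -/
def fam {n p : ℕ} (hp1 : 1 ≤ p) (hpn : p ≤ n) {α : Type*}
    (A : Fin (p - 1) → α) (H : α) (L : Fin (n - p) → α) : Fin n → α :=
  fun i =>
    if h : (i : ℕ) < p - 1 then A ⟨i, h⟩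
    else if h2 : (i : ℕ) = p - 1 then H
    else L ⟨(i : ℕ) - p, by have := i.isLt; omega⟩


namespace AFI

/-- Lorentzian transfer. -/
lemma lor_transfer {V : Type*} [AddCommGroup V] [Module ℝ V] (Q : V →ₗ[ℝ] V →ₗ[ℝ] ℝ)
    (hs : ∀ x y, Q x y = Q y x) (w v : V) (hw : 0 < Q w w) (hv : 0 < Q v v)
    (h : ∀ x, Q x x * Q w w ≤ Q x w ^ 2) (x : V) : Q x x * Q v v ≤ Q x v ^ 2 := by
  have h1 := h v
  have h2 := h (Q v w • x - Q x w • v)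
  have hz : Q (Q v w • x - Q x w • v) w = 0 := by
    simp; ring
  rw [hz] at h2
  have h3 : Q (Q v w • x - Q x w • v) (Q v w • x - Q x w • v)
      = Q v w ^ 2 * Q x x - 2 * Q v w * Q x w * Q x v + Q x w ^ 2 * Q v v := by
    simp [hs v x]; ring
  have h4 : Q v w ^ 2 * Q x x - 2 * Q v w * Q x w * Q x v + Q x w ^ 2 * Q v v ≤ 0 := by
    rw [← h3]
    by_contra hc
    push Not at hc
    have := mul_pos hc hw
    nlinarith
  have h5 : 0 < Q v w ^ 2 := by nlinarith [mul_pos hv hw]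
  by_contra hc
  push Not at hc
  have h6 := mul_pos h5 (sub_pos.2 hc)
  have h7 := mul_nonpos_of_nonpos_of_nonneg h4 hv.le
  nlinarith [sq_nonneg (Q x w * Q v v - Q v w * Q x v)]

lemma spec_sum {κ : Type} [Fintype κ] [DecidableEq κ] (S : Matrix κ κ ℝ) (hS : S.IsHermitian)
    (g : κ → ℝ) (x : κ → ℝ)
    (hpos : ∀ (lam : ℝ) (y : κ → ℝ), 0 < lam → S.mulVec y = lam • y → ∃ c : ℝ, y = c • g)
    (hx : x ⬝ᵥ g = 0) : x ⬝ᵥ S.mulVec x ≤ 0 := by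
  classical
  let b := hS.eigenvectorBasis
  let X : EuclideanSpace ℝ κ := WithLp.toLp 2 x
  have hxe : X = ∑ i, inner ℝ (b i) X • b i := (b.sum_repr' X).symm
  have hx2 : x = ∑ i, inner ℝ (b i) X • (b i).ofLp := by
    have := congrArg WithLp.ofLp hxe
    simpa [X] using this
  have hSx : S.mulVec x = ∑ i, (inner ℝ (b i) X * hS.eigenvalues i) • (b i).ofLp := by
    conv_lhs => rw [hx2]
    rw [Matrix.mulVec_sum]
    refine Finset.sum_congr rfl fun i _ => ?_
    rw [Matrix.mulVec_smul, hS.mulVec_eigenvectorBasis i, smul_smul]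
  have hin : ∀ i, x ⬝ᵥ (b i).ofLp = inner ℝ (b i) X := by
    intro i
    simp [X, EuclideanSpace.inner_eq_star_dotProduct]
  rw [hSx, dotProduct_sum]
  refine Finset.sum_nonpos fun i _ => ?_
  rw [dotProduct_smul, hin, smul_eq_mul]
  rcases le_or_gt (hS.eigenvalues i) 0 with hl | hl
  · nlinarith [mul_nonneg_of_nonpos_of_nonpos hl (neg_nonpos.2 (sq_nonneg (inner ℝ (b i) X)))]
  · obtain ⟨c, hc⟩ := hpos _ _ hl (hS.mulVec_eigenvectorBasis i)
    have : inner ℝ (b i) X = (0:ℝ) := by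
      rw [← hin]
      have hc' : (b i).ofLp = c • g := hc
      rw [hc', dotProduct_smul, hx]; simp
    rw [this]; simp

lemma ground {κ : Type} [Fintype κ] (M : κ → κ → ℝ) (hs : ∀ i j, M i j = M j i)
    (g z : κ → ℝ) (hg : ∀ i, 0 < g i) :
    ∑ i, ∑ j, M i j * z i * z j = ∑ i, (z i ^ 2 / g i) * ∑ j, M i j * g j
      - (1/2) * ∑ i, ∑ j, M i j * g i * g j * (z i / g i - z j / g j) ^ 2 := by
  have e1 : ∀ i j, M i j * g i * g j * (z i / g i - z j / g j) ^ 2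
      = M i j * g j * (z i ^ 2 / g i) - 2 * (M i j * z i * z j) + M i j * g i * (z j ^ 2 / g j) := by
    intro i j
    have := (hg i).ne'
    have := (hg j).ne'
    field_simp
    ring
  have e2 : ∑ i, ∑ j, M i j * g i * (z j ^ 2 / g j) = ∑ i, ∑ j, M i j * g j * (z i ^ 2 / g i) := by
    rw [Finset.sum_comm]
    refine Finset.sum_congr rfl fun i _ => Finset.sum_congr rfl fun j _ => ?_
    rw [hs]
  simp_rw [e1, Finset.sum_add_distrib, Finset.sum_sub_distrib]
  rw [e2]
  simp_rw [← Finset.mul_sum]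
  have e3 : ∑ i, (z i ^ 2 / g i) * ∑ j, M i j * g j = ∑ i, ∑ j, M i j * g j * (z i ^ 2 / g i) := by
    refine Finset.sum_congr rfl fun i _ => ?_
    rw [Finset.mul_sum]
    exact Finset.sum_congr rfl fun j _ => by ring
  rw [e3]
  ring

/-- The Bochner step together with Perron-Frobenius. -/
lemma bochner {κ : Type} [Fintype κ] [DecidableEq κ] (M : κ → κ → ℝ) (hs : ∀ i j, M i j = M j i)
    (hoff : ∀ i j, i ≠ j → 0 ≤ M i j) (v p : κ → ℝ) (hv : ∀ i, 0 < v i) (hp : ∀ i, 0 < p i)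
    (hMv : ∀ i, ∑ j, M i j * v j = p i)
    (hconn : ∀ c : κ → ℝ, (∀ i j, i ≠ j → 0 < M i j → c i = c j) → ∀ i j, c i = c j)
    (hq : ∀ x : κ → ℝ, ∑ i, ∑ j, M i j * x i * x j ≤ ∑ i, (∑ j, M i j * x j) ^ 2 * v i / p i)
    (x : κ → ℝ) (hx : ∑ i, x i * p i = 0) :
    ∑ i, ∑ j, M i j * x i * x j ≤ 0 := by
  classical
  set D : κ → ℝ := fun i => Real.sqrt (v i / p i) with hD
  have hDpos : ∀ i, 0 < D i := fun i => Real.sqrt_pos.2 (div_pos (hv i) (hp i))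
  have hD2 : ∀ i, D i * D i = v i / p i := fun i =>
    Real.mul_self_sqrt (div_pos (hv i) (hp i)).le
  let S : Matrix κ κ ℝ := fun i j => D i * M i j * D j
  have hS : S.IsHermitian := by
    ext i j
    change D j * M j i * D i = D i * M i j * D j
    rw [hs j i]; ring
  have key := spec_sum S hS (fun i => v i / D i) (fun i => x i / D i) ?_ ?_
  · have : (fun i => x i / D i) ⬝ᵥ S.mulVec (fun i => x i / D i)
        = ∑ i, ∑ j, M i j * x i * x j := by
      simp only [dotProduct, Matrix.mulVec, S, Finset.mul_sum]
      refine Finset.sum_congr rfl fun i _ => Finset.sum_congr rfl fun j _ => ?_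
      have := (hDpos i).ne'
      have := (hDpos j).ne'
      field_simp
    rwa [this] at key
  · intro lam y hlam hy
    -- z = D y
    set z : κ → ℝ := fun i => D i * y i with hz
    have hy' : ∀ i, D i * ∑ j, M i j * z j = lam * y i := by
      intro i
      have := congrFun hy i
      simp only [Matrix.mulVec, dotProduct, S, Pi.smul_apply, smul_eq_mul] at this
      rw [← this, Finset.mul_sum]
      exact Finset.sum_congr rfl fun j _ => by simp only [hz]; ring
    have hA : ∑ i, ∑ j, M i j * z i * z j = lam * ∑ i, y i ^ 2 := by
      rw [Finset.mul_sum]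
      refine Finset.sum_congr rfl fun i _ => ?_
      have : ∑ j, M i j * z i * z j = y i * (D i * ∑ j, M i j * z j) := by
        simp only [Finset.mul_sum]
        exact Finset.sum_congr rfl fun j _ => by simp only [hz]; ring
      rw [this, hy']; ring
    have hB : ∑ i, (∑ j, M i j * z j) ^ 2 * v i / p i = lam ^ 2 * ∑ i, y i ^ 2 := by
      rw [Finset.mul_sum]
      refine Finset.sum_congr rfl fun i _ => ?_
      have : (∑ j, M i j * z j) ^ 2 * v i / p i = (D i * ∑ j, M i j * z j) ^ 2 := by
        rw [mul_pow, sq (D i), hD2]; ring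
      rw [this, hy']; ring
    have hAB := hq z
    rw [hA, hB] at hAB
    have hG := ground M hs v z hv
    rw [hA] at hG
    have hC : ∑ i, (z i ^ 2 / v i) * ∑ j, M i j * v j = ∑ i, y i ^ 2 := by
      refine Finset.sum_congr rfl fun i _ => ?_
      rw [hMv]
      simp only [hz, mul_pow, sq (D i), hD2]
      have := (hv i).ne'
      have := (hp i).ne'
      field_simp
    rw [hC] at hG
    have hterm : ∀ i j, 0 ≤ M i j * v i * v j * (z i / v i - z j / v j) ^ 2 := by
      intro i j
      by_cases hij : i = j
      · subst hij; simp
      · have := hoff i j hij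
        have := hv i
        have := hv j
        positivity
    have hn : 0 ≤ ∑ i, ∑ j, M i j * v i * v j * (z i / v i - z j / v j) ^ 2 :=
      Finset.sum_nonneg fun i _ => Finset.sum_nonneg fun j _ => hterm i j
    have hy0 : 0 ≤ ∑ i, y i ^ 2 := Finset.sum_nonneg fun i _ => sq_nonneg _
    have hsum0 : ∑ i, ∑ j, M i j * v i * v j * (z i / v i - z j / v j) ^ 2 = 0 := by
      rcases hy0.eq_or_lt with h0 | h0
      · rw [← h0] at hG; nlinarith
      · have : 1 ≤ lam := by
          by_contra hc
          push Not at hc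
          nlinarith [mul_pos (mul_pos hlam (sub_pos.2 hc)) h0]
        nlinarith [mul_nonneg (sub_nonneg.2 this) h0.le]
    have hc : ∀ i j, i ≠ j → 0 < M i j → z i / v i = z j / v j := by
      intro i j _ hm
      have h1 := (Finset.sum_eq_zero_iff_of_nonneg (fun i _ => Finset.sum_nonneg
        fun j _ => hterm i j)).1 hsum0 i (Finset.mem_univ i)
      have h2 := (Finset.sum_eq_zero_iff_of_nonneg (fun j _ => hterm i j)).1 h1 j
        (Finset.mem_univ j)
      have h3 : M i j * v i * v j ≠ 0 := (mul_pos (mul_pos hm (hv i)) (hv j)).ne'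
      have h4 := (mul_eq_zero.1 h2).resolve_left h3
      exact sub_eq_zero.1 (pow_eq_zero_iff (two_ne_zero) |>.1 h4)
    have hcc := hconn (fun i => z i / v i) hc
    by_cases hne : Nonempty κ
    · obtain ⟨i0⟩ := hne
      refine ⟨z i0 / v i0, ?_⟩
      ext i
      have h5 := hcc i i0
      simp only [Pi.smul_apply, smul_eq_mul]
      rw [← h5]
      have := (hv i).ne'
      have := (hDpos i).ne'
      simp only [hz]
      field_simp
    · exact ⟨0, funext fun i => (hne ⟨i⟩).elim⟩
  · rw [← hx]
    refine Finset.sum_congr rfl fun i _ => ?_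
    have h1 := hD2 i
    have := (hDpos i).ne'
    have := (hp i).ne'
    have h2 : v i = D i * D i * p i := by rw [h1]; field_simp
    simp only
    rw [h2]
    field_simp

/-- Ground state: negative semidefinite. -/
lemma ground_neg {κ : Type} [Fintype κ] (M : κ → κ → ℝ) (hs : ∀ i j, M i j = M j i)
    (hoff : ∀ i j, i ≠ j → 0 ≤ M i j)
    (g z : κ → ℝ) (hg : ∀ i, 0 < g i) (hMg : ∀ i, ∑ j, M i j * g j ≤ 0) :
    ∑ i, ∑ j, M i j * z i * z j ≤ 0 := by
  rw [ground M hs g z hg]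
  have h1 : ∑ i, (z i ^ 2 / g i) * ∑ j, M i j * g j ≤ 0 :=
    Finset.sum_nonpos fun i _ => mul_nonpos_of_nonneg_of_nonpos
      (div_nonneg (sq_nonneg _) (hg i).le) (hMg i)
  have h2 : 0 ≤ ∑ i, ∑ j, M i j * g i * g j * (z i / g i - z j / g j) ^ 2 := by
    refine Finset.sum_nonneg fun i _ => Finset.sum_nonneg fun j _ => ?_
    by_cases hij : i = j
    · subst hij; simp
    · have := hoff i j hij
      have := hg i
      have := hg j
      positivity
  linarith

end AFI

namespace AFI

/-- A complete simplicial fan (combinatorial data). -/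
structure Fan (n : ℕ) (ι : Type) [Fintype ι] [DecidableEq ι] where
  u : ι → Fin n → ℝ
  Bs : Finset (Finset ι)
  card_eq : ∀ B ∈ Bs, B.card = n
  X : Finset ι → (ι → ℝ) →ₗ[ℝ] (Fin n → ℝ)
  hX : ∀ B ∈ Bs, ∀ h, ∀ i ∈ B, u i ⬝ᵥ X B h = h i
  span : ∀ B ∈ Bs, ∀ w, ∃ γ : ι → ℝ, w = ∑ i ∈ B, γ i • u i
  complete : ∀ w, ∃ B ∈ Bs, ∃ γ : ι → ℝ, (∀ i ∈ B, 0 ≤ γ i) ∧ w = ∑ i ∈ B, γ i • u i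

section
variable {n : ℕ} {ι : Type} [Fintype ι] [DecidableEq ι]

/-- The open type cone. -/
def Fan.C (Φ : Fan n ι) (h : ι → ℝ) : Prop := ∀ B ∈ Φ.Bs, ∀ j, j ∉ B → Φ.u j ⬝ᵥ Φ.X B h < h j

/-- translation vectors -/
def Fan.τ (Φ : Fan n ι) (y : Fin n → ℝ) : ι → ℝ := fun i => Φ.u i ⬝ᵥ y

/-- multiset of unit vectors -/
def ev (σ : Finset ι) : Multiset (ι → ℝ) := σ.val.map (fun i => Pi.single i (1:ℝ))

lemma ev_insert {σ : Finset ι} {i : ι} (h : i ∉ σ) :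
    ev (insert i σ) = (Pi.single i (1:ℝ)) ::ₘ ev σ := by
  simp [ev, Finset.insert_val_of_notMem h]

/-- σ is a face -/
def Fan.Face (Φ : Fan n ι) (σ : Finset ι) : Prop := ∃ B ∈ Φ.Bs, σ ⊆ B

instance (Φ : Fan n ι) (σ : Finset ι) : Decidable (Φ.Face σ) := by
  unfold Fan.Face; infer_instance

/-- The algebraic properties of the volume form. -/
structure Form (Φ : Fan n ι) (F : Multiset (ι → ℝ) → ℝ) : Prop where
  add : ∀ a b s, F ((a + b) ::ₘ s) = F (a ::ₘ s) + F (b ::ₘ s)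
  smul : ∀ (c : ℝ) a s, F ((c • a) ::ₘ s) = c * F (a ::ₘ s)
  trans : ∀ y s, F (Φ.τ y ::ₘ s) = 0
  non : ∀ σ, ¬ Φ.Face σ → ∀ s, F (s + ev σ) = 0
  pos : ∀ B ∈ Φ.Bs, 0 < F (ev B)

variable {Φ : Fan n ι} {F : Multiset (ι → ℝ) → ℝ}

lemma Form.sub (hF : Form Φ F) (a b s) : F ((a - b) ::ₘ s) = F (a ::ₘ s) - F (b ::ₘ s) := by
  have := hF.smul (-1) b s
  rw [sub_eq_add_neg, hF.add, ← neg_one_smul ℝ b, this]; ring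

/-- partial linear map -/
def Form.lin (hF : Form Φ F) (s : Multiset (ι → ℝ)) : (ι → ℝ) →ₗ[ℝ] ℝ where
  toFun a := F (a ::ₘ s)
  map_add' a b := hF.add a b s
  map_smul' c a := hF.smul c a s

lemma Form.expand (hF : Form Φ F) (h : ι → ℝ) (s) :
    F (h ::ₘ s) = ∑ i, h i * F (Pi.single i 1 ::ₘ s) := by
  have e : h = ∑ i, h i • (Pi.single i (1:ℝ) : ι → ℝ) := by
    ext j; simp [Finset.sum_apply, Pi.single_apply]
  have : hF.lin s h = ∑ i, h i • hF.lin s (Pi.single i 1) := by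
    conv_lhs => rw [e]
    simp [map_sum]
  exact this

/-- bilinear form -/
def Form.bil (hF : Form Φ F) (s : Multiset (ι → ℝ)) : (ι → ℝ) →ₗ[ℝ] (ι → ℝ) →ₗ[ℝ] ℝ :=
  LinearMap.mk₂ ℝ (fun a b => F (a ::ₘ b ::ₘ s)) (fun a b c => hF.add a b _)
    (fun c a b => hF.smul c a _)
    (fun a b c => by
      rw [Multiset.cons_swap, hF.add, Multiset.cons_swap b, Multiset.cons_swap c])
    (fun c a b => by rw [Multiset.cons_swap, hF.smul, Multiset.cons_swap b]; rfl)

lemma Form.bil_apply (hF : Form Φ F) (s a b) : hF.bil s a b = F (a ::ₘ b ::ₘ s) := rfl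

lemma Form.bil_symm (hF : Form Φ F) (s a b) : hF.bil s a b = hF.bil s b a := by
  rw [hF.bil_apply, hF.bil_apply, Multiset.cons_swap]

lemma Form.subτ (hF : Form Φ F) (a y s) : F ((a - Φ.τ y) ::ₘ s) = F (a ::ₘ s) := by
  rw [hF.sub, hF.trans, sub_zero]

lemma Fan.C.le {h : ι → ℝ} (hh : Φ.C h) {B} (hB : B ∈ Φ.Bs) (j : ι) :
    Φ.u j ⬝ᵥ Φ.X B h ≤ h j := by
  by_cases hj : j ∈ B
  · exact (Φ.hX B hB h j hj).le
  · exact (hh B hB j hj).le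

lemma Fan.dot_sum (Φ : Fan n ι) (B : Finset ι) (γ : ι → ℝ) (x : Fin n → ℝ) :
    (∑ i ∈ B, γ i • Φ.u i) ⬝ᵥ x = ∑ i ∈ B, γ i * (Φ.u i ⬝ᵥ x) := by
  rw [sum_dotProduct]
  exact Finset.sum_congr rfl fun i _ => by rw [smul_dotProduct, smul_eq_mul]

/-- dual vectors -/
lemma Fan.dual_same (Φ : Fan n ι) {B} (hB : B ∈ Φ.Bs) {j} (hj : j ∈ B) :
    Φ.u j ⬝ᵥ Φ.X B (Pi.single j 1) = 1 := by
  rw [Φ.hX B hB _ j hj]; simp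

lemma Fan.dual_ne (Φ : Fan n ι) {B} (hB : B ∈ Φ.Bs) {i j} (hi : i ∈ B) (hij : i ≠ j) :
    Φ.u i ⬝ᵥ Φ.X B (Pi.single j 1) = 0 := by
  rw [Φ.hX B hB _ i hi]; simp [hij]

lemma Form.exchange (hF : Form Φ F) {B} (hB : B ∈ Φ.Bs) {j} (hj : j ∈ B) :
    ∃ l, l ∉ B ∧ insert l (B.erase j) ∈ Φ.Bs := by
  by_contra hc
  push Not at hc
  have h0 := hF.trans (Φ.X B (Pi.single j 1)) (ev (B.erase j))
  rw [hF.expand, Finset.sum_eq_single j] at h0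
  · rw [← ev_insert (Finset.notMem_erase j B), Finset.insert_erase hj] at h0
    simp only [Fan.τ, Φ.dual_same hB hj, one_mul] at h0
    exact absurd h0 (hF.pos B hB).ne'
  · intro l _ hlj
    by_cases hl : l ∈ B
    · simp only [Fan.τ, Φ.dual_ne hB hl hlj, zero_mul]
    · have hl' : l ∉ B.erase j := fun h => hl (Finset.mem_of_mem_erase h)
      rw [← ev_insert hl']
      have := hF.non (insert l (B.erase j)) (by
        rintro ⟨B', hB', hsub⟩
        have : insert l (B.erase j) = B' := by
          apply Finset.eq_of_subset_of_card_le hsub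
          rw [Finset.card_insert_of_notMem hl', Finset.card_erase_of_mem hj, Φ.card_eq B' hB',
            Φ.card_eq B hB]
          omega
        exact hc l hl (this ▸ hB')) 0
      rw [zero_add] at this
      rw [this, mul_zero]
  · simp

lemma Form.relint (hF : Form Φ F) {h : ι → ℝ} (hh : Φ.C h) {σ} (hσ : Φ.Face σ) :
    ∃ y, (∀ i ∈ σ, Φ.u i ⬝ᵥ y = h i) ∧ ∀ i, i ∉ σ → Φ.u i ⬝ᵥ y < h i := by
  obtain ⟨B0, hB0, hσB0⟩ := hσ
  set S := Φ.Bs.filter (fun B => σ ⊆ B) with hS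
  have hB0S : B0 ∈ S := by simp [hS, hB0, hσB0]
  have hk : (0:ℝ) < S.card := by exact_mod_cast Finset.card_pos.2 ⟨B0, hB0S⟩
  refine ⟨(S.card : ℝ)⁻¹ • ∑ B ∈ S, Φ.X B h, ?_, ?_⟩
  · intro i hi
    rw [dotProduct_smul, dotProduct_sum, Finset.sum_congr rfl (g := fun _ => h i)]
    · simp; field_simp
    · intro B hB
      simp only [hS, Finset.mem_filter] at hB
      exact Φ.hX B hB.1 h i (hB.2 hi)
  · intro i hi
    rw [dotProduct_smul, dotProduct_sum]
    have : ∑ B ∈ S, Φ.u i ⬝ᵥ Φ.X B h < ∑ B ∈ S, h i := by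
      apply Finset.sum_lt_sum
      · intro B hB
        simp only [hS, Finset.mem_filter] at hB
        exact hh.le hB.1 i
      · by_cases hiB : i ∈ B0
        · obtain ⟨l, hl, hl2⟩ := hF.exchange hB0 hiB
          refine ⟨insert l (B0.erase i), ?_, ?_⟩
          · simp only [hS, Finset.mem_filter]
            refine ⟨hl2, fun k hk => ?_⟩
            have : k ≠ i := fun h => hi (h ▸ hk)
            simp [this, hσB0 hk]
          · apply hh _ hl2
            simp only [Finset.mem_insert, Finset.mem_erase, not_or]
            exact ⟨fun h => hl (h ▸ hiB), by simp⟩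
        · exact ⟨B0, hB0S, hh B0 hB0 i hiB⟩
    rw [Finset.sum_const, nsmul_eq_mul] at this
    rw [smul_eq_mul, inv_mul_lt_iff₀ hk]
    exact this

/-- Reduction to the link. -/
lemma Form.rsum (hF : Form Φ F) {σ : Finset ι} (x : ι → ℝ) (hx : ∀ i ∈ σ, x i = 0) (t) :
    F (x ::ₘ (t + ev σ)) = ∑ i : {i // i ∉ σ ∧ Φ.Face (insert i σ)},
      x i * F (Pi.single i.1 1 ::ₘ (t + ev σ)) := by
  rw [hF.expand, ← Fintype.sum_subtype_add_sum_subtype (fun i => i ∉ σ ∧ Φ.Face (insert i σ))]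
  rw [add_eq_left]
  refine Finset.sum_eq_zero fun i _ => ?_
  by_cases hi : i.1 ∈ σ
  · rw [hx _ hi, zero_mul]
  · have h2 : ¬ Φ.Face (insert i.1 σ) := fun h => i.2 ⟨hi, h⟩
    rw [← Multiset.add_cons, ← ev_insert hi, hF.non _ h2, mul_zero]

lemma Form.posC (hF : Form Φ F) (s : Multiset (ι → ℝ)) :
    ∀ σ, Φ.Face σ → (∀ h ∈ s, Φ.C h) → σ.card + Multiset.card s = n → 0 < F (s + ev σ) := by
  induction s using Multiset.induction_on with
  | empty =>
    intro σ ⟨B, hB, hσ⟩ _ hc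
    have : σ = B := Finset.eq_of_subset_of_card_le hσ (by rw [Φ.card_eq B hB]; simp at hc; omega)
    rw [zero_add, this]
    exact hF.pos B hB
  | cons h s ih =>
    intro σ hσ hs hc
    obtain ⟨y, hy1, hy2⟩ := hF.relint (hs h (by simp)) hσ
    rw [Multiset.cons_add, ← hF.subτ h y, hF.rsum]
    · have hterm : ∀ i : {i // i ∉ σ ∧ Φ.Face (insert i σ)},
          0 < (h - Φ.τ y) i.1 * F (Pi.single i.1 1 ::ₘ (s + ev σ)) := by
        rintro ⟨i, hi, hf⟩
        apply mul_pos
        · have := hy2 i hi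
          simp only [Pi.sub_apply, Fan.τ]; linarith
        · rw [← Multiset.add_cons, ← ev_insert hi]
          apply ih _ hf (fun h hh => hs h (by simp [hh]))
          rw [Finset.card_insert_of_notMem hi]
          simp at hc; omega
      obtain ⟨B, hB, hσB⟩ := hσ
      have : ∃ i ∈ B, i ∉ σ := by
        by_contra hcon
        push Not at hcon
        have := Finset.card_le_card hcon
        rw [Φ.card_eq B hB] at this
        simp at hc; omega
      obtain ⟨i, hiB, hi⟩ := this
      apply Finset.sum_pos (fun i _ => hterm i)
      exact ⟨⟨i, hi, B, hB, by
        intro k hk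
        rcases Finset.mem_insert.1 hk with rfl | hk
        · exact hiB
        · exact hσB hk⟩, Finset.mem_univ _⟩
    · intro i hi
      simp [Fan.τ, hy1 i hi]

lemma Form.off (hF : Form Φ F) (s : Multiset (ι → ℝ)) {σ : Finset ι} (hs : ∀ h ∈ s, Φ.C h)
    (hc : σ.card + Multiset.card s + 2 = n) {i j} (hi : i ∉ σ) (hj : j ∉ σ) (hij : i ≠ j) :
    (Φ.Face (insert i (insert j σ)) ∧ 0 < F (Pi.single i 1 ::ₘ Pi.single j 1 ::ₘ (s + ev σ))) ∨
    (¬ Φ.Face (insert i (insert j σ)) ∧ F (Pi.single i 1 ::ₘ Pi.single j 1 ::ₘ (s + ev σ)) = 0) := by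
  have hi' : i ∉ insert j σ := by simp [hij, hi]
  rw [← Multiset.add_cons, ← ev_insert hj, ← Multiset.add_cons, ← ev_insert hi']
  by_cases hf : Φ.Face (insert i (insert j σ))
  · left
    refine ⟨hf, hF.posC s _ hf hs ?_⟩
    rw [Finset.card_insert_of_notMem hi', Finset.card_insert_of_notMem hj]; omega
  · right
    exact ⟨hf, hF.non _ hf s⟩

/-- a pivot step -/
lemma Form.pivot_step (hF : Form Φ F) {h0} (h0C : Φ.C h0) {σ B : Finset ι} (hB : B ∈ Φ.Bs)
    (hσ : σ ⊆ B) (w : Fin n → ℝ) (γ : ι → ℝ) (hγ : w = ∑ i ∈ B, γ i • Φ.u i) {j} (hj : j ∈ B)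
    (hjσ : j ∉ σ) (hneg : γ j < 0) :
    ∃ B' ∈ Φ.Bs, B.erase j ⊆ B' ∧ σ ⊆ B' ∧ w ⬝ᵥ Φ.X B h0 < w ⬝ᵥ Φ.X B' h0 := by
  obtain ⟨l, hl, hl2⟩ := hF.exchange hB hj
  refine ⟨_, hl2, Finset.subset_insert _ _, fun k hk => ?_, ?_⟩
  · have : k ≠ j := fun h => hjσ (h ▸ hk)
    simp [this, hσ hk]
  · rw [hγ, Φ.dot_sum, Φ.dot_sum]
    apply Finset.sum_lt_sum
    · intro i hi
      by_cases hij : i = j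
      · subst hij
        rw [Φ.hX B hB h0 i hi]
        have := h0C.le hl2 i
        nlinarith
      · rw [Φ.hX B hB h0 i hi, Φ.hX _ hl2 h0 i (by simp [hij, hi])]
    · refine ⟨j, hj, ?_⟩
      rw [Φ.hX B hB h0 j hj]
      have := h0C _ hl2 j (by
        simp only [Finset.mem_insert, Finset.mem_erase, not_or]
        exact ⟨fun h => hl (h ▸ hj), by simp⟩)
      nlinarith

lemma Form.pivot (hF : Form Φ F) {h0} (h0C : Φ.C h0) {σ : Finset ι} (hσ : Φ.Face σ)
    (w : Fin n → ℝ) : ∃ B ∈ Φ.Bs, σ ⊆ B ∧ ∃ γ : ι → ℝ, w = ∑ i ∈ B, γ i • Φ.u i ∧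
      ∀ j ∈ B, j ∉ σ → 0 ≤ γ j := by
  obtain ⟨B0, hB0, hσB0⟩ := hσ
  obtain ⟨B, hB, hmax⟩ := Finset.exists_max_image (Φ.Bs.filter (fun B => σ ⊆ B))
    (fun B => w ⬝ᵥ Φ.X B h0) ⟨B0, by simp [hB0, hσB0]⟩
  simp only [Finset.mem_filter] at hB hmax
  obtain ⟨γ, hγ⟩ := Φ.span B hB.1 w
  refine ⟨B, hB.1, hB.2, γ, hγ, fun j hj hjσ => ?_⟩
  by_contra hneg
  push Not at hneg
  obtain ⟨B', hB', _, hσ', hlt⟩ := hF.pivot_step h0C hB.1 hB.2 w γ hγ hj hjσ hneg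
  exact absurd (hmax B' ⟨hB', hσ'⟩) (not_le.2 hlt)

lemma Fan.cone_unique {h0} (h0C : Φ.C h0) {σ B B' : Finset ι} (hB : B ∈ Φ.Bs) (hB' : B' ∈ Φ.Bs)
    (hσ : σ ⊆ B) (hσ' : σ ⊆ B') (α β : ι → ℝ) (hα : ∀ l ∈ B, l ∉ σ → 0 ≤ α l)
    (hβ : ∀ l ∈ B', l ∉ σ → 0 ≤ β l) (heq : ∑ l ∈ B, α l • Φ.u l = ∑ l ∈ B', β l • Φ.u l)
    {l} (hl : l ∈ B) (hlσ : l ∉ σ) (hpos : 0 < α l) : l ∈ B' := by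
  by_contra hlB'
  have h1 : (∑ l ∈ B, α l • Φ.u l) ⬝ᵥ Φ.X B' h0 < (∑ l ∈ B, α l • Φ.u l) ⬝ᵥ Φ.X B h0 := by
    rw [Φ.dot_sum, Φ.dot_sum]
    apply Finset.sum_lt_sum
    · intro i hi
      rw [Φ.hX B hB h0 i hi]
      by_cases his : i ∈ σ
      · rw [Φ.hX B' hB' h0 i (hσ' his)]
      · exact mul_le_mul_of_nonneg_left (h0C.le hB' i) (hα i hi his)
    · refine ⟨l, hl, ?_⟩
      rw [Φ.hX B hB h0 l hl]
      exact mul_lt_mul_of_pos_left (h0C B' hB' l hlB') hpos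
  have h2 : (∑ l ∈ B', β l • Φ.u l) ⬝ᵥ Φ.X B h0 ≤ (∑ l ∈ B', β l • Φ.u l) ⬝ᵥ Φ.X B' h0 := by
    rw [Φ.dot_sum, Φ.dot_sum]
    apply Finset.sum_le_sum
    intro i hi
    rw [Φ.hX B' hB' h0 i hi]
    by_cases his : i ∈ σ
    · rw [Φ.hX B hB h0 i (hσ his)]
    · exact mul_le_mul_of_nonneg_left (h0C.le hB i) (hβ i hi his)
  rw [← heq] at h2
  linarith

/-- links are connected -/
lemma Form.conn (hF : Form Φ F) {h0} (h0C : Φ.C h0) {σ : Finset ι} (hc : σ.card + 2 ≤ n)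
    (c : ι → ℝ) (hcc : ∀ i j, i ∉ σ → j ∉ σ → i ≠ j → Φ.Face (insert i (insert j σ)) → c i = c j)
    {i j} (hi : i ∉ σ) (hj : j ∉ σ) (hfi : Φ.Face (insert i σ)) (hfj : Φ.Face (insert j σ)) :
    c i = c j := by
  obtain ⟨B0, hB0, hB0s⟩ := hfi
  obtain ⟨B1, hB1, hB1s⟩ := hfj
  have hconst : ∀ B ∈ Φ.Bs, σ ⊆ B → ∀ k ∈ B, ∀ l ∈ B, k ∉ σ → l ∉ σ → c k = c l := by
    intro B hB hσ k hk l hl hks hls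
    by_cases hkl : k = l
    · rw [hkl]
    · refine hcc k l hks hls hkl ⟨B, hB, ?_⟩
      intro m hm
      rcases Finset.mem_insert.1 hm with rfl | hm
      · exact hk
      · rcases Finset.mem_insert.1 hm with rfl | hm
        · exact hl
        · exact hσ hm
  have hσ0 : σ ⊆ B0 := fun k hk => hB0s (Finset.mem_insert_of_mem hk)
  have hσ1 : σ ⊆ B1 := fun k hk => hB1s (Finset.mem_insert_of_mem hk)
  have hiB0 : i ∈ B0 := hB0s (Finset.mem_insert_self _ _)
  have hjB1 : j ∈ B1 := hB1s (Finset.mem_insert_self _ _)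
  set w : Fin n → ℝ := ∑ k ∈ B0 \ σ, (1:ℝ) • Φ.u k with hw
  set bad := Φ.Bs.filter (fun B => σ ⊆ B ∧ ∃ k ∈ B, k ∉ σ ∧ c i ≠ c k) with hbad
  by_cases hne : bad.Nonempty
  · exfalso
    obtain ⟨B, hB, hmax⟩ := Finset.exists_max_image bad (fun B => w ⬝ᵥ Φ.X B h0) hne
    simp only [hbad, Finset.mem_filter] at hB hmax
    obtain ⟨hB, hσB, k, hk, hks, hck⟩ := hB
    obtain ⟨γ, hγ⟩ := Φ.span B hB w
    by_cases hall : ∀ l ∈ B, l ∉ σ → 0 ≤ γ l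
    · -- B = B0
      have hsub : B0 ⊆ B := by
        intro m hm
        by_cases hms : m ∈ σ
        · exact hσB hms
        · refine Fan.cone_unique h0C hB0 hB hσ0 hσB (fun l => if l ∈ σ then 0 else 1) γ ?_ hall ?_
            hm hms (by simp [hms])
          · intro l _ hl; simp [hl]
          · rw [← hγ, hw, ← Finset.sum_sdiff hσ0]
            rw [Finset.sum_congr rfl (g := fun k => (1:ℝ) • Φ.u k), add_eq_left]
            · exact Finset.sum_eq_zero fun l hl => by simp [hl]
            · intro l hl
              simp [(Finset.mem_sdiff.1 hl).2]
      have hBB : B0 = B := Finset.eq_of_subset_of_card_le hsub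
        (by rw [Φ.card_eq B hB, Φ.card_eq B0 hB0])
      subst hBB
      exact hck (hconst B0 hB hσB i hiB0 k hk hi hks)
    · push Not at hall
      obtain ⟨l, hl, hls, hneg⟩ := hall
      obtain ⟨B', hB', hsub, hσ', hlt⟩ := hF.pivot_step h0C hB hσB w γ hγ hl hls hneg
      have hnb : ∀ m ∈ B', m ∉ σ → c i = c m := by
        intro m hm hms
        by_contra hcon
        exact absurd (hmax B' ⟨hB', hσ', m, hm, hms, hcon⟩) (not_le.2 hlt)
      have : ∃ m ∈ B.erase l, m ∉ σ := by
        by_contra hcon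
        push Not at hcon
        have := Finset.card_le_card hcon
        rw [Finset.card_erase_of_mem hl, Φ.card_eq B hB] at this
        omega
      obtain ⟨m, hm, hms⟩ := this
      have h1 := hnb m (hsub hm) hms
      have h2 := hconst B hB hσB m (Finset.mem_of_mem_erase hm) k hk hms hks
      exact hck (h1.trans h2)
  · by_contra hcon
    exact hne ⟨B1, by simp only [hbad, Finset.mem_filter]; exact ⟨hB1, hσ1, j, hjB1, hj, hcon⟩⟩

end
end AFI

namespace AFI
section
variable {n : ℕ} {ι : Type} [Fintype ι] [DecidableEq ι] {Φ : Fan n ι} {F : Multiset (ι → ℝ) → ℝ}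

lemma Form.expand2 (hF : Form Φ F) (x : ι → ℝ) (s) (P : ι → Prop) [DecidablePred P]
    (hx : ∀ i, ¬ P i → x i = 0) :
    F (x ::ₘ x ::ₘ s) = ∑ i : {i // P i}, ∑ j : {i // P i},
      F (Pi.single i.1 1 ::ₘ Pi.single j.1 1 ::ₘ s) * x i * x j := by
  have red : ∀ g : ι → ℝ, (∀ i, ¬ P i → g i = 0) → ∑ i, g i = ∑ i : {i // P i}, g i := by
    intro g hg
    rw [← Fintype.sum_subtype_add_sum_subtype P, add_eq_left]
    exact Finset.sum_eq_zero fun i _ => hg _ i.2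
  rw [hF.expand, red]
  · refine Finset.sum_congr rfl fun i _ => ?_
    rw [Multiset.cons_swap, hF.expand, red, Finset.mul_sum]
    · refine Finset.sum_congr rfl fun j _ => ?_
      rw [Multiset.cons_swap]; ring
    · intro j hj; rw [hx j hj]; ring
  · intro j hj; rw [hx j hj]; ring

lemma Form.base_z (hF : Form Φ F) {h0} (h0C : Φ.C h0) {σ B0 B : Finset ι} (hc : σ.card + 2 = n)
    (hB0 : B0 ∈ Φ.Bs) (hσ0 : σ ⊆ B0) (hB : B ∈ Φ.Bs) (hσB : σ ⊆ B) {i} (hi0 : i ∈ B0)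
    (hiσ : i ∉ σ) (hiB : i ∉ B) (γ : ι → ℝ) (hγ : - Φ.u i = ∑ l ∈ B, γ l • Φ.u l)
    (hγ0 : ∀ l ∈ B, l ∉ σ → 0 ≤ γ l) (z : ι → ℝ) (hz : ∀ l ∈ B, z l = 0) (hzi : z i = 0) :
    F (z ::ₘ z ::ₘ (0 + ev σ)) ≤ 0 := by
  have hcd : (B \ σ).card = 2 := by
    rw [Finset.card_sdiff_of_subset hσB, Φ.card_eq B hB]; omega
  obtain ⟨j, k, hjk, hjks⟩ := Finset.card_eq_two.1 hcd
  have hj : j ∈ B ∧ j ∉ σ := by rw [← Finset.mem_sdiff, hjks]; simp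
  have hk : k ∈ B ∧ k ∉ σ := by rw [← Finset.mem_sdiff, hjks]; simp
  have hBsum : ∀ f : ι → (Fin n → ℝ), ∑ l ∈ B, f l = f j + f k + ∑ l ∈ σ, f l := by
    intro f
    rw [← Finset.sum_sdiff hσB, hjks, Finset.sum_pair hjk]
  have hb := hγ0 j hj.1 hj.2
  have hcc := hγ0 k hk.1 hk.2
  have hbc : 0 < γ j * γ j + γ k * γ k := by
    rcases hb.lt_or_eq with h | h
    · nlinarith [mul_pos h h, mul_self_nonneg (γ k)]
    rcases hcc.lt_or_eq with h' | h'
    · nlinarith [mul_pos h' h', mul_self_nonneg (γ j)]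
    exfalso
    rw [hBsum, ← h, ← h', zero_smul, zero_smul, add_zero, zero_add] at hγ
    have h3 := congrArg (fun w => w ⬝ᵥ Φ.X B0 (Pi.single i 1)) hγ
    simp only [neg_dotProduct, Φ.dual_same hB0 hi0, Φ.dot_sum] at h3
    rw [Finset.sum_eq_zero] at h3
    · norm_num at h3
    · intro l hl
      rw [Φ.dual_ne hB0 (hσ0 hl) (fun h : l = i => hiσ (h ▸ hl)), mul_zero]
  set q : ι → ℝ := Pi.single j (γ k) - Pi.single k (γ j) with hq
  set θ : ι → ℝ := fun l => Φ.u l ⬝ᵥ Φ.X B q with hθ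
  have hθB : ∀ l ∈ B, θ l = q l := fun l hl => Φ.hX B hB q l hl
  have hqj : q j = γ k := by simp [hq, hjk]
  have hqk : q k = - γ j := by simp [hq, hjk.symm]
  have hqσ : ∀ l ∈ σ, q l = 0 := by
    intro l hl
    have h1 : l ≠ j := fun h => hj.2 (h ▸ hl)
    have h2 : l ≠ k := fun h => hk.2 (h ▸ hl)
    simp [hq, h1, h2]
  have hdot : ∀ α : ι → ℝ, (∑ l ∈ B, α l • Φ.u l) ⬝ᵥ Φ.X B q = α j * γ k - α k * γ j := by
    intro α
    rw [Φ.dot_sum, ← Finset.sum_sdiff hσB, hjks, Finset.sum_pair hjk, Φ.hX B hB q j hj.1,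
      Φ.hX B hB q k hk.1, hqj, hqk, Finset.sum_eq_zero]
    · ring
    · intro l hl
      rw [Φ.hX B hB q l (hσB hl), hqσ l hl, mul_zero]
  have hθi : θ i = 0 := by
    have := congrArg (fun w => w ⬝ᵥ Φ.X B q) hγ
    simp only [neg_dotProduct, hdot] at this
    simp only [hθ]; linarith
  have W : ∀ w : Fin n → ℝ, w ⬝ᵥ Φ.X B q = 0 → ∃ (s : ℝ) (δ : ι → ℝ),
      w = -(s • Φ.u i) + ∑ l ∈ σ, δ l • Φ.u l := by
    intro w hw
    obtain ⟨α, hα⟩ := Φ.span B hB w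
    rw [hα, hdot] at hw
    set s := (α j * γ j + α k * γ k) / (γ j * γ j + γ k * γ k) with hs
    have h1 : α j = s * γ j := by
      rw [hs, div_mul_eq_mul_div, eq_div_iff hbc.ne']; linear_combination γ k * hw
    have h2 : α k = s * γ k := by
      rw [hs, div_mul_eq_mul_div, eq_div_iff hbc.ne']; linear_combination (-γ j) * hw
    refine ⟨s, fun l => α l - s * γ l, ?_⟩
    rw [hα, ← smul_neg, hγ, hBsum, hBsum, h1, h2]
    simp only [smul_add, sub_smul, Finset.sum_sub_distrib, Finset.smul_sum, mul_smul]
    abel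
  -- consequences of W
  have W2 : ∀ (B1 : Finset ι) (α : ι → ℝ), B1 ∈ Φ.Bs → σ ⊆ B1 → (∀ l ∈ B1, l ∉ σ → 0 ≤ α l) →
      (∑ l ∈ B1, α l • Φ.u l) ⬝ᵥ Φ.X B q = 0 → ∀ l ∈ B1, l ∉ σ → l ≠ i → 0 < α l → l ∈ B := by
    intro B1 α hB1 hσ1 hα hw l hl hlσ hli hpos
    obtain ⟨s, δ, hs⟩ := W _ hw
    rcases le_or_gt 0 s with h | h
    · refine Fan.cone_unique h0C hB1 hB hσ1 hσB α (fun l => s * γ l + if l ∈ σ then δ l else 0)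
        hα ?_ ?_ hl hlσ hpos
      · intro m hm hmσ
        simp only [hmσ, if_false, add_zero]
        exact mul_nonneg h (hγ0 m hm hmσ)
      · rw [hs, ← smul_neg, hγ]
        simp only [add_smul, Finset.sum_add_distrib, Finset.smul_sum, mul_smul, ite_smul, zero_smul]
        rw [Finset.sum_ite_mem, Finset.inter_eq_right.2 hσB]
    · exfalso
      have hrep : ∑ l ∈ B1, α l • Φ.u l = ∑ l ∈ B0, ((if l = i then -s else 0) +
          (if l ∈ σ then δ l else 0)) • Φ.u l := by
        rw [hs]
        simp only [add_smul, Finset.sum_add_distrib, ite_smul, zero_smul]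
        rw [Finset.sum_ite_mem, Finset.inter_eq_right.2 hσ0, Finset.sum_ite_eq' B0 i]
        simp [hi0]
      have hl0 : l ∈ B0 := by
        refine Fan.cone_unique h0C hB1 hB0 hσ1 hσ0 α _ hα ?_ hrep hl hlσ hpos
        intro m hm hmσ
        by_cases hmi : m = i
        · simp [hmi, hiσ, h.le]
        · simp [hmi, hmσ]
      have hi1 : i ∈ B1 := by
        refine Fan.cone_unique h0C hB0 hB1 hσ0 hσ1 _ α ?_ hα hrep.symm hi0 hiσ (by simp [hiσ, h])
        intro m hm hmσ
        by_cases hmi : m = i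
        · simp [hmi, hiσ, h.le]
        · simp [hmi, hmσ]
      have e1 := congrArg (fun w => w ⬝ᵥ Φ.X B1 (Pi.single l 1)) hs
      simp only [Φ.dot_sum, add_dotProduct, neg_dotProduct, smul_dotProduct] at e1
      rw [Φ.dual_ne hB1 hi1 hli.symm, Finset.sum_eq_single l, Φ.dual_same hB1 hl,
        Finset.sum_eq_zero] at e1
      · simp at e1; linarith
      · intro m hm
        rw [Φ.dual_ne hB1 (hσ1 hm) (fun h : m = l => hlσ (h ▸ hm)), mul_zero]
      · intro m hm hml
        rw [Φ.dual_ne hB1 hm hml, mul_zero]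
      · intro h; exact absurd hl h
  let P : ι → Prop := fun l => l ∉ insert i B ∧ Φ.Face (insert l σ)
  have hPσ : ∀ l, l ∉ insert i B → l ∉ σ := fun l hl h => hl (Finset.mem_insert_of_mem (hσB h))
  have hθ0 : ∀ l, P l → θ l ≠ 0 := by
    rintro l ⟨hl, B1, hB1, hs1⟩ h
    simp only [Finset.mem_insert, not_or] at hl
    have hl1 : l ∈ B1 := hs1 (Finset.mem_insert_self _ _)
    have hls : l ∉ σ := fun h => hl.2 (hσB h)
    refine hl.2 (W2 B1 (fun m => if m = l then 1 else 0) hB1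
      (fun m hm => hs1 (Finset.mem_insert_of_mem hm)) ?_ ?_ l hl1 hls hl.1 (by simp))
    · intro m _ _; split_ifs <;> norm_num
    · simp only [ite_smul, one_smul, zero_smul]
      rw [Finset.sum_ite_eq' B1 l, if_pos hl1]; exact h
  have hM := fun {a b : ι} (ha : a ∉ σ) (hb : b ∉ σ) (hab : a ≠ b) =>
    hF.off 0 (σ := σ) (by simp) (by simpa using hc) ha hb hab
  have hcross : ∀ l, P l → ∀ l', l' ≠ l → l' ∉ σ → l' ≠ i → θ l * θ l' < 0 →
      F (Pi.single l 1 ::ₘ Pi.single l' 1 ::ₘ (0 + ev σ)) = 0 := by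
    rintro l ⟨hl, -⟩ l' hll hl's hl'i hneg
    have hls := hPσ l hl
    simp only [Finset.mem_insert, not_or] at hl
    rcases hM hls hl's hll.symm with ⟨⟨B1, hB1, hs1⟩, _⟩ | h
    · exfalso
      have hl1 : l ∈ B1 := hs1 (by simp)
      have hl1' : l' ∈ B1 := hs1 (by simp)
      refine hl.2 (W2 B1 (fun m => (if m = l then |θ l'| else 0) + (if m = l' then |θ l| else 0)) hB1
        (fun m hm => hs1 (by simp [hm])) ?_ ?_ l hl1 hls hl.1 ?_)
      · intro m _ _; split_ifs <;> positivity
      · simp only [add_smul, Finset.sum_add_distrib, ite_smul, zero_smul]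
        rw [Finset.sum_ite_eq' B1 l, if_pos hl1, Finset.sum_ite_eq' B1 l', if_pos hl1',
          add_dotProduct, smul_dotProduct, smul_dotProduct]
        change |θ l'| * θ l + |θ l| * θ l' = 0
        rcases mul_neg_iff.1 hneg with ⟨h1, h2⟩ | ⟨h1, h2⟩
        · rw [abs_of_neg h2, abs_of_pos h1]; ring
        · rw [abs_of_neg h1, abs_of_pos h2]; ring
      · have : θ l' ≠ 0 := fun h => by simp [h] at hneg
        simp only [if_true, if_neg hll.symm, add_zero]
        positivity
    · exact h.2
  -- reduce to ground_neg
  set z' : ι → ℝ := fun l => if P l then z l else 0 with hz'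
  have hzz : F (z ::ₘ z ::ₘ (0 + ev σ)) = F (z' ::ₘ z' ::ₘ (0 + ev σ)) := by
    have key : ∀ t, F (z ::ₘ (t + ev σ)) = F (z' ::ₘ (t + ev σ)) := by
      intro t
      rw [hF.rsum z (fun l hl => hz l (hσB hl)), hF.rsum z' (fun l hl => ?_)]
      · refine Finset.sum_congr rfl fun l _ => ?_
        by_cases hP : P l.1
        · simp [hz', hP]
        · have : l.1 ∈ insert i B := by
            by_contra h; exact hP ⟨h, l.2.2⟩
          rcases Finset.mem_insert.1 this with h | h
          · simp [hz', hP, h, hzi]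
          · simp [hz', hP, hz _ h]
      · have : ¬ P l := fun h => hPσ l h.1 hl
        simp [hz', this]
    rw [← Multiset.cons_add, key, Multiset.cons_add, Multiset.cons_swap, ← Multiset.cons_add, key,
      Multiset.cons_add]
  rw [hzz, hF.expand2 z' _ P (fun l hl => by simp [hz', hl])]
  refine ground_neg (fun a b : {l // P l} => F (Pi.single a.1 1 ::ₘ Pi.single b.1 1 ::ₘ (0 + ev σ)))
    ?_ ?_ (fun a => |θ a.1|) (fun a => z' a.1) ?_ ?_
  · intro a b; rw [Multiset.cons_swap]
  · intro a b hab
    rcases hM (hPσ _ a.2.1) (hPσ _ b.2.1) (fun h => hab (Subtype.ext h)) with h | h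
    · exact h.2.le
    · exact h.2.ge
  · intro a; exact abs_pos.2 (hθ0 _ a.2)
  · rintro ⟨l, hl⟩
    have h0 := hF.trans (Φ.X B q) (Pi.single l 1 ::ₘ (0 + ev σ))
    rw [hF.expand, ← Fintype.sum_subtype_add_sum_subtype P] at h0
    have hpos : 0 < |θ l| := abs_pos.2 (hθ0 _ hl)
    have hA : ∑ m : {m // P m}, F (Pi.single l 1 ::ₘ Pi.single m.1 1 ::ₘ (0 + ev σ)) * |θ m.1| * |θ l|
        = (∑ m : {m // P m}, Φ.τ (Φ.X B q) m.1 *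
          F (Pi.single m.1 1 ::ₘ Pi.single l 1 ::ₘ (0 + ev σ))) * θ l := by
      rw [Finset.sum_mul]
      refine Finset.sum_congr rfl fun m _ => ?_
      change _ = θ m.1 * _ * θ l
      rw [Multiset.cons_swap]
      have habs : 0 ≤ θ l * θ m.1 → |θ m.1| * |θ l| = θ m.1 * θ l := by
        intro h; rw [← abs_mul, abs_of_nonneg (by linarith [mul_comm (θ l) (θ m.1)])]
      by_cases hml : m.1 = l
      · have := habs (by rw [hml]; exact mul_self_nonneg _)
        linear_combination F (Pi.single m.1 1 ::ₘ Pi.single l 1 ::ₘ (0 + ev σ)) * this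
      · rcases lt_or_ge (θ l * θ m.1) 0 with h | h
        · rw [Multiset.cons_swap, hcross l hl m.1 hml (hPσ _ m.2.1) (fun h => m.2.1 (by simp [h])) h]
          ring
        · have := habs h
          linear_combination F (Pi.single m.1 1 ::ₘ Pi.single l 1 ::ₘ (0 + ev σ)) * this
    have hBn : 0 ≤ (∑ m : {m // ¬ P m}, Φ.τ (Φ.X B q) m.1 *
          F (Pi.single m.1 1 ::ₘ Pi.single l 1 ::ₘ (0 + ev σ))) * θ l := by
      rw [Finset.sum_mul]
      refine Finset.sum_nonneg fun m _ => ?_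
      change 0 ≤ θ m.1 * _ * θ l
      by_cases hmσ : m.1 ∈ σ
      · rw [hθB _ (hσB hmσ), hqσ _ hmσ]; simp
      by_cases hmi : m.1 = i
      · rw [hmi, hθi]; simp
      have hml : m.1 ≠ l := fun h => m.2 (h ▸ hl)
      rcases lt_or_ge (θ l * θ m.1) 0 with h | h
      · rw [Multiset.cons_swap, hcross l hl m.1 hml hmσ hmi h]
        simp
      · have : 0 ≤ F (Pi.single m.1 1 ::ₘ Pi.single l 1 ::ₘ (0 + ev σ)) := by
          rcases hM hmσ (hPσ _ hl.1) hml with h | h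
          · exact h.2.le
          · exact h.2.ge
        nlinarith [mul_nonneg h this]
    have h1 : (∑ m : {m // P m}, F (Pi.single l 1 ::ₘ Pi.single m.1 1 ::ₘ (0 + ev σ)) * |θ m.1|) * |θ l|
        ≤ 0 := by
      rw [Finset.sum_mul, hA]
      have h5 := congrArg (fun t => t * θ l) h0
      simp only [add_mul, zero_mul] at h5
      linarith only [h5, hBn]
    by_contra hcon
    push Not at hcon
    exact absurd (mul_pos hcon hpos) (not_lt.2 h1)

lemma Form.base (hF : Form Φ F) {h0} (h0C : Φ.C h0) {σ : Finset ι} (hc : σ.card + 2 = n)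
    (hσ : Φ.Face σ) {v : ι → ℝ} (hv : Φ.C v) (x : ι → ℝ) :
    F (x ::ₘ x ::ₘ (0 + ev σ)) * F (v ::ₘ v ::ₘ (0 + ev σ)) ≤ F (x ::ₘ v ::ₘ (0 + ev σ)) ^ 2 := by
  obtain ⟨B0, hB0, hσ0⟩ := hσ
  obtain ⟨i, hi0, hiσ⟩ : ∃ i ∈ B0, i ∉ σ := by
    by_contra hcon
    push Not at hcon
    have := Finset.card_le_card hcon
    rw [Φ.card_eq B0 hB0] at this
    omega
  obtain ⟨B, hB, hσB, γ, hγ, hγ0⟩ := hF.pivot h0C ⟨B0, hB0, hσ0⟩ (- Φ.u i)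
  have hiB : i ∉ B := by
    intro hi
    have h3 := congrArg (fun w => w ⬝ᵥ Φ.X B (Pi.single i 1)) hγ
    simp only [neg_dotProduct, Φ.dual_same hB hi, Φ.dot_sum] at h3
    rw [Finset.sum_eq_single i, Φ.dual_same hB hi] at h3
    · linarith [hγ0 i hi hiσ]
    · intro m hm hmi
      rw [Φ.dual_ne hB hm hmi, mul_zero]
    · intro h; exact absurd hi h
  have hNv : 0 < v i - Φ.u i ⬝ᵥ Φ.X B v := by linarith [hv B hB i hiB]
  set r := (x i - Φ.u i ⬝ᵥ Φ.X B x) / (v i - Φ.u i ⬝ᵥ Φ.X B v) with hr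
  have hr' : r * (v i - Φ.u i ⬝ᵥ Φ.X B v) = x i - Φ.u i ⬝ᵥ Φ.X B x := by
    rw [hr]; field_simp
  have hQ := hF.base_z h0C hc hB0 hσ0 hB hσB hi0 hiσ hiB γ hγ hγ0
    ((x - r • v) - Φ.τ (Φ.X B (x - r • v))) (fun l hl => by
      simp only [Pi.sub_apply, Fan.τ, Φ.hX B hB _ l hl]; simp) (by
      simp only [Pi.sub_apply, Fan.τ, map_sub, map_smul, dotProduct_sub, dotProduct_smul,
        Pi.smul_apply, smul_eq_mul]
      linarith)
  rw [hF.subτ, Multiset.cons_swap, hF.subτ, ← hF.bil_apply] at hQ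
  simp only [map_sub, LinearMap.sub_apply, map_smul, LinearMap.smul_apply, smul_eq_mul,
    hF.bil_symm _ v x] at hQ
  simp only [hF.bil_apply] at hQ
  have hvv : 0 < F (v ::ₘ v ::ₘ (0 + ev σ)) := by
    have := hF.posC {v, v} σ ⟨B0, hB0, hσ0⟩ (by simp [hv]) (by simpa using hc)
    simpa using this
  nlinarith [sq_nonneg (F (x ::ₘ v ::ₘ (0 + ev σ)) - r * F (v ::ₘ v ::ₘ (0 + ev σ)))]

lemma Form.AF (hF : Form Φ F) {h0} (h0C : Φ.C h0) (s : Multiset (ι → ℝ)) :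
    ∀ σ : Finset ι, (∀ h ∈ s, Φ.C h) → σ.card + Multiset.card s + 2 = n → Φ.Face σ →
    ∀ v, Φ.C v → ∀ x, F (x ::ₘ x ::ₘ (s + ev σ)) * F (v ::ₘ v ::ₘ (s + ev σ)) ≤
      F (x ::ₘ v ::ₘ (s + ev σ)) ^ 2 := by
  induction s using Multiset.induction_on with
  | empty =>
    intro σ _ hc hσ v hv x
    exact hF.base h0C (by simpa using hc) hσ hv x
  | cons v3 s ih =>
    intro σ hs hc hσ v hv x
    have hv3 : Φ.C v3 := hs v3 (by simp)
    have hs' : ∀ h ∈ s, Φ.C h := fun h hh => hs h (by simp [hh])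
    rw [Multiset.card_cons] at hc
    have hpos2 : ∀ w, Φ.C w → 0 < F (w ::ₘ w ::ₘ ((v3 ::ₘ s) + ev σ)) := by
      intro w hw
      have := hF.posC (w ::ₘ w ::ₘ v3 ::ₘ s) σ hσ (by
        intro h hh
        simp only [Multiset.mem_cons] at hh
        rcases hh with rfl | rfl | rfl | hh
        exacts [hw, hw, hv3, hs' _ hh]) (by simp; omega)
      simpa using this
    obtain ⟨y, hy1, hy2⟩ := hF.relint hv3 hσ
    have hmain : ∀ x : ι → ℝ, F (x ::ₘ v3 ::ₘ ((v3 ::ₘ s) + ev σ)) = 0 →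
        F (x ::ₘ x ::ₘ ((v3 ::ₘ s) + ev σ)) ≤ 0 := by
      intro x hx
      obtain ⟨B0, hB0, hσ0⟩ := id hσ
      set x' := x - Φ.τ (Φ.X B0 x) with hx'
      have hx'0 : ∀ i ∈ σ, x' i = 0 := by
        intro i hi
        simp [hx', Fan.τ, Φ.hX B0 hB0 x i (hσ0 hi)]
      have hxx : F (x' ::ₘ x' ::ₘ ((v3 ::ₘ s) + ev σ)) = F (x ::ₘ x ::ₘ ((v3 ::ₘ s) + ev σ)) := by
        rw [hx', hF.subτ, Multiset.cons_swap, hF.subτ]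
      have hxv : F (x' ::ₘ v3 ::ₘ ((v3 ::ₘ s) + ev σ)) = 0 := by
        rw [hx', hF.subτ, hx]
      let κ := {i // i ∉ σ ∧ Φ.Face (insert i σ)}
      let M : κ → κ → ℝ := fun i j => F (Pi.single i.1 1 ::ₘ Pi.single j.1 1 ::ₘ (v3 ::ₘ s + ev σ))
      have quad : ∀ x : ι → ℝ, (∀ i ∈ σ, x i = 0) → F (x ::ₘ x ::ₘ ((v3 ::ₘ s) + ev σ)) =
          ∑ i : κ, ∑ j : κ, M i j * x i * x j := by
        intro x hx
        rw [← Multiset.cons_add, hF.rsum x hx]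
        refine Finset.sum_congr rfl fun i _ => ?_
        rw [Multiset.cons_add, Multiset.cons_swap, ← Multiset.cons_add, hF.rsum x hx, Finset.mul_sum]
        refine Finset.sum_congr rfl fun j _ => ?_
        rw [Multiset.cons_add, Multiset.cons_swap]
        simp only [M]; ring
      have lin : ∀ (x : ι → ℝ), (∀ i ∈ σ, x i = 0) → ∀ i : κ,
          F (x ::ₘ v3 ::ₘ (s + ev (insert i.1 σ))) = ∑ j, M i j * x j := by
        intro x hx i
        rw [ev_insert i.2.1, Multiset.add_cons, Multiset.cons_swap v3, ← Multiset.cons_add,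
          ← Multiset.cons_add, hF.rsum x hx]
        refine Finset.sum_congr rfl fun j _ => ?_
        rw [Multiset.cons_add, Multiset.cons_swap]
        simp only [M]; ring
      have hp : ∀ i : κ, 0 < F (v3 ::ₘ v3 ::ₘ (s + ev (insert i.1 σ))) := by
        intro i
        have := hF.posC (v3 ::ₘ v3 ::ₘ s) (insert i.1 σ) i.2.2 (by
          intro h hh
          simp only [Multiset.mem_cons] at hh
          rcases hh with rfl | rfl | hh
          exacts [hv3, hv3, hs' _ hh]) (by
            rw [Finset.card_insert_of_notMem i.2.1]; simp; omega)
        simpa using this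
      have hw0 : ∀ i ∈ σ, (v3 - Φ.τ y) i = 0 := by
        intro i hi; simp [Fan.τ, hy1 i hi]
      have hoff := fun (i j : κ) (hij : i ≠ j) => hF.off (v3 ::ₘ s) (σ := σ) hs
        (by simp; omega) i.2.1 j.2.1 (fun h => hij (Subtype.ext h))
      rw [← hxx, quad x' hx'0]
      refine bochner M (fun i j => by simp only [M]; rw [Multiset.cons_swap]) ?_
        (fun i => (v3 - Φ.τ y) i.1) (fun i => F (v3 ::ₘ v3 ::ₘ (s + ev (insert i.1 σ)))) ?_ hp ?_ ?_ ?_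
        (fun i => x' i.1) ?_
      · intro i j hij
        rcases hoff i j hij with h | h
        · exact h.2.le
        · exact h.2.ge
      · intro i
        have := hy2 i.1 i.2.1
        simp only [Pi.sub_apply, Fan.τ]; linarith
      · intro i
        rw [← lin _ hw0, hF.subτ]
      · intro c hcc i j
        have := hF.conn h0C (σ := σ) (by omega)
          (fun l => if h : l ∉ σ ∧ Φ.Face (insert l σ) then c ⟨l, h⟩ else 0) ?_ i.2.1 j.2.1 i.2.2 j.2.2
        · simpa [i.2, j.2] using this
        · intro a b ha hb hab hf
          have hfa : Φ.Face (insert a σ) := by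
            obtain ⟨B, hB, h⟩ := hf
            refine ⟨B, hB, fun m hm => h ?_⟩
            rcases Finset.mem_insert.1 hm with h | h <;> simp [h]
          have hfb : Φ.Face (insert b σ) := by
            obtain ⟨B, hB, h⟩ := hf
            exact ⟨B, hB, fun m hm => h (Finset.mem_insert_of_mem hm)⟩
          rw [dif_pos ⟨ha, hfa⟩, dif_pos ⟨hb, hfb⟩]
          have hne : (⟨a, ha, hfa⟩ : κ) ≠ ⟨b, hb, hfb⟩ := fun h => hab (congrArg Subtype.val h)
          refine hcc _ _ hne ?_
          rcases hoff ⟨a, ha, hfa⟩ ⟨b, hb, hfb⟩ hne with h | h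
          · exact h.2
          · exact absurd hf h.1
      · intro z
        set z' : ι → ℝ := fun l => if h : l ∉ σ ∧ Φ.Face (insert l σ) then z ⟨l, h⟩ else 0 with hz'
        have hzz : ∀ i : κ, z' i.1 = z i := fun i => by simp [hz', i.2]
        have hz'0 : ∀ i ∈ σ, z' i = 0 := by
          intro i hi; simp [hz', hi]
        have e1 : ∑ i, ∑ j, M i j * z i * z j = F (z' ::ₘ z' ::ₘ (v3 ::ₘ s + ev σ)) := by
          rw [quad z' hz'0]; simp only [hzz]
        have e2 : F (z' ::ₘ z' ::ₘ (v3 ::ₘ s + ev σ)) =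
            ∑ i : κ, (v3 - Φ.τ y) i.1 * F (z' ::ₘ z' ::ₘ (s + ev (insert i.1 σ))) := by
          have : F (z' ::ₘ z' ::ₘ (v3 ::ₘ s + ev σ)) = F (v3 ::ₘ ((z' ::ₘ z' ::ₘ s) + ev σ)) := by
            congr 1
            simp only [Multiset.cons_add]
            rw [Multiset.cons_swap z' v3, Multiset.cons_swap z' v3]
          rw [this, ← hF.subτ v3 y, hF.rsum _ hw0]
          refine Finset.sum_congr rfl fun i _ => ?_
          rw [ev_insert i.2.1, ← Multiset.add_cons, ← Multiset.cons_add, ← Multiset.cons_add]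
        rw [e1, e2]
        refine Finset.sum_le_sum fun i _ => ?_
        have hIH := ih (insert i.1 σ) hs' (by rw [Finset.card_insert_of_notMem i.2.1]; omega)
          i.2.2 v3 hv3 z'
        rw [lin z' hz'0 i] at hIH
        simp only [hzz] at hIH
        rw [le_div_iff₀ (hp i), mul_assoc, mul_comm]
        refine mul_le_mul_of_nonneg_right hIH ?_
        have := hy2 i.1 i.2.1
        simp only [Pi.sub_apply, Fan.τ]; linarith
      · have h1 := hxv
        rw [Multiset.cons_add, ← Multiset.cons_add, ← Multiset.cons_add, hF.rsum _ hx'0] at h1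
        rw [← h1]
        refine Finset.sum_congr rfl fun i _ => ?_
        rw [ev_insert i.2.1, ← Multiset.cons_add, ← Multiset.cons_add, Multiset.add_cons]
    have hv33 := hpos2 v3 hv3
    have := lor_transfer (hF.bil ((v3 ::ₘ s) + ev σ)) (hF.bil_symm _) v3 v hv33 (hpos2 v hv) ?_ x
    · exact this
    · intro z
      set Q := hF.bil ((v3 ::ₘ s) + ev σ) with hQ
      have hQ33 : 0 < Q v3 v3 := hv33
      have h1 := hmain (z - (Q z v3 / Q v3 v3) • v3) (by
        rw [← hF.bil_apply, ← hQ]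
        simp only [map_sub, LinearMap.sub_apply, map_smul, LinearMap.smul_apply, smul_eq_mul]
        field_simp; ring)
      rw [← hF.bil_apply, ← hQ] at h1
      simp only [map_sub, LinearMap.sub_apply, map_smul, LinearMap.smul_apply, smul_eq_mul,
        hF.bil_symm _ v3 z, ← hQ] at h1
      have h2 : Q v3 z = Q z v3 := hF.bil_symm _ _ _
      rw [h2] at h1
      have h3 : Q z z - Q z v3 ^ 2 / Q v3 v3 ≤ 0 := by
        refine le_trans (le_of_eq ?_) h1
        field_simp; ring
      rw [sub_nonpos, le_div_iff₀ hQ33] at h3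
      exact h3

end
end AFI

namespace AFI

lemma comb {α : Type} [Fintype α] [DecidableEq α] {m : ℕ} (hm : 0 < m) (d : Multiset α → ℝ)
    (hd0 : ∀ a, d (Multiset.replicate m a) = 0)
    (hd : ∀ a b t, Multiset.card t + 2 = m → d (a ::ₘ a ::ₘ t) + d (b ::ₘ b ::ₘ t) ≤ 2 * d (a ::ₘ b ::ₘ t))
    (s : Multiset α) (hs : Multiset.card s = m) : 0 ≤ d s := by
  obtain ⟨s0, -, hs0⟩ := Finset.exists_min_image (Finset.univ : Finset (Sym α m))
    (fun s => d s.1) ⟨⟨s, hs⟩, Finset.mem_univ _⟩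
  have hmin : ∀ t : Multiset α, Multiset.card t = m → d s0.1 ≤ d t :=
    fun t ht => hs0 ⟨t, ht⟩ (Finset.mem_univ _)
  have hne : ∃ a0, a0 ∈ s0.1 := Multiset.card_pos_iff_exists_mem.1 (by rw [s0.2]; exact hm)
  obtain ⟨a0, ha0⟩ := hne
  obtain ⟨⟨s1, a⟩, h1, h2⟩ := Finset.exists_max_image
    ((Finset.univ : Finset (Sym α m × α)).filter (fun x => d x.1.1 = d s0.1))
    (fun x => Multiset.count x.2 x.1.1) ⟨(s0, a0), Finset.mem_filter.2 ⟨Finset.mem_univ _, rfl⟩⟩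
  simp only [Finset.mem_filter, Finset.mem_univ, true_and, Prod.forall] at h1 h2
  have ha : a ∈ s1.1 := by
    rw [← Multiset.count_pos]
    exact lt_of_lt_of_le (Multiset.count_pos.2 ha0) (h2 s0 a0 rfl)
  have hrep : s1.1 = Multiset.replicate m a := by
    rw [Multiset.eq_replicate]
    refine ⟨s1.2, fun b hb => ?_⟩
    by_contra hba
    obtain ⟨t1, ht1⟩ := Multiset.exists_cons_of_mem ha
    rw [ht1] at hb
    have hb' : b ∈ t1 := by
      rcases Multiset.mem_cons.1 hb with h | h
      · exact absurd h hba
      · exact h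
    obtain ⟨t, ht⟩ := Multiset.exists_cons_of_mem hb'
    rw [ht] at ht1
    have hc : Multiset.card t + 2 = m := by
      have := s1.2
      change Multiset.card s1.1 = m at this
      rw [ht1] at this; simpa using this
    have hA := hmin (a ::ₘ a ::ₘ t) (by simp; omega)
    have hB := hmin (b ::ₘ b ::ₘ t) (by simp; omega)
    have hAB := hd a b t hc
    rw [← ht1, h1] at hAB
    have := h2 ⟨a ::ₘ a ::ₘ t, by simp; omega⟩ a (by
      change d (a ::ₘ a ::ₘ t) = d s0.1; linarith)
    change Multiset.count a (a ::ₘ a ::ₘ t) ≤ Multiset.count a s1.1 at this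
    rw [ht1] at this
    simp [Multiset.count_cons_of_ne (Ne.symm hba)] at this
  rw [← hd0 a, ← hrep, h1]
  exact hmin s hs

lemma comb_mul {α : Type} [Fintype α] [DecidableEq α] {m : ℕ} (hm : 0 < m) (G : Multiset α → ℝ)
    (hpos : ∀ s, Multiset.card s = m → 0 < G s)
    (hG : ∀ a b t, Multiset.card t + 2 = m → G (a ::ₘ a ::ₘ t) * G (b ::ₘ b ::ₘ t) ≤ G (a ::ₘ b ::ₘ t) ^ 2)
    (s : Multiset α) (hs : Multiset.card s = m) :
    (s.map (fun a => G (Multiset.replicate m a))).prod ≤ G s ^ m := by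
  have key := comb hm (fun s => m * Real.log (G s) -
    (s.map (fun a => Real.log (G (Multiset.replicate m a)))).sum) ?_ ?_ s hs
  · have hp : ∀ a, 0 < G (Multiset.replicate m a) := fun a => hpos _ (by simp)
    have e : ∀ t : Multiset α, 0 < (t.map (fun a => G (Multiset.replicate m a))).prod ∧
        Real.log (t.map (fun a => G (Multiset.replicate m a))).prod =
      (t.map (fun a => Real.log (G (Multiset.replicate m a)))).sum := by
      intro t
      induction t using Multiset.induction_on with
      | empty => simp
      | cons a t ih =>
        simp only [Multiset.map_cons, Multiset.prod_cons, Multiset.sum_cons]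
        exact ⟨mul_pos (hp a) ih.1, by rw [Real.log_mul (hp a).ne' ih.1.ne', ih.2]⟩
    rw [← Real.log_le_log_iff (e s).1 (pow_pos (hpos s hs) _), (e s).2, Real.log_pow]
    linarith
  · intro a; simp
  · intro a b t ht
    have h1 := hpos (a ::ₘ a ::ₘ t) (by simp; omega)
    have h2 := hpos (b ::ₘ b ::ₘ t) (by simp; omega)
    have h3 := hpos (a ::ₘ b ::ₘ t) (by simp; omega)
    have h4 := Real.log_le_log (mul_pos h1 h2) (hG a b t ht)
    rw [Real.log_mul h1.ne' h2.ne', Real.log_pow] at h4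
    simp only [Multiset.map_cons, Multiset.sum_cons]
    push_cast at h4
    have h5 : (0:ℝ) < m := by exact_mod_cast hm
    nlinarith

section
variable {n : ℕ} {ι : Type} [Fintype ι] [DecidableEq ι] {Φ : Fan n ι} {F : Multiset (ι → ℝ) → ℝ}

/-- The inequality for a form, in the type cone. -/
lemma Form.ineq (hF : Form Φ F) {m : ℕ} (hm : 0 < m) (g : Fin m → ι → ℝ) (hg : ∀ i, Φ.C (g i))
    (r : Multiset (ι → ℝ)) (hr : ∀ h ∈ r, Φ.C h) (hn : m + Multiset.card r = n) :
    ∏ i, F (Multiset.replicate m (g i) + r) ≤ F (Finset.univ.val.map g + r) ^ m := by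
  have hne : Φ.Face ∅ := by
    obtain ⟨B, hB, _⟩ := Φ.complete 0
    exact ⟨B, hB, by simp⟩
  have hev : ∀ s : Multiset (ι → ℝ), s + ev (∅ : Finset ι) = s := by intro s; simp [ev]
  have hC : ∀ s : Multiset (Fin m), ∀ h ∈ s.map g + r, Φ.C h := by
    intro s h hh
    rcases Multiset.mem_add.1 hh with h1 | h1
    · obtain ⟨i, _, rfl⟩ := Multiset.mem_map.1 h1
      exact hg i
    · exact hr h h1
  have := comb_mul hm (fun s => F (s.map g + r)) ?_ ?_ (Finset.univ : Finset (Fin m)).val (by simp)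
  · simpa [Finset.prod] using this
  · intro s hs
    have := hF.posC (s.map g + r) ∅ hne (hC s) (by simp; omega)
    rwa [hev] at this
  · intro a b t ht
    have := hF.AF (hg ⟨0, hm⟩) (t.map g + r) ∅ (hC t) (by simp; omega) hne (g b) (hg b) (g a)
    rw [hev] at this
    simpa using this

end
end AFI

namespace AFI
section
variable {n : ℕ} {ι : Type} [Fintype ι] [DecidableEq ι] {Φ : Fan n ι}

/-- the polytope -/
def Fan.P (Φ : Fan n ι) (h : ι → ℝ) : Set (Fin n → ℝ) := {x | ∀ i, Φ.u i ⬝ᵥ x ≤ h i}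

/-- the closed type cone -/
def Fan.Cw (Φ : Fan n ι) (h : ι → ℝ) : Prop := ∀ B ∈ Φ.Bs, ∀ j, Φ.u j ⬝ᵥ Φ.X B h ≤ h j

lemma Fan.C.w {h : ι → ℝ} (hh : Φ.C h) : Φ.Cw h := fun _ hB j => hh.le hB j

lemma Fan.Cw.add {h h' : ι → ℝ} (hh : Φ.Cw h) (hh' : Φ.Cw h') : Φ.Cw (h + h') := by
  intro B hB j
  have := hh B hB j
  have := hh' B hB j
  simp only [map_add, dotProduct_add, Pi.add_apply]; linarith

lemma Fan.Cw.add_C {h h' : ι → ℝ} (hh : Φ.Cw h) (hh' : Φ.C h') : Φ.C (h + h') := by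
  intro B hB j hj
  have := hh B hB j
  have := hh' B hB j hj
  simp only [map_add, dotProduct_add, Pi.add_apply]; linarith

lemma Fan.C.smul {h : ι → ℝ} (hh : Φ.C h) {c : ℝ} (hc : 0 < c) : Φ.C (c • h) := by
  intro B hB j hj
  simp only [map_smul, dotProduct_smul, Pi.smul_apply, smul_eq_mul]
  exact mul_lt_mul_of_pos_left (hh B hB j hj) hc

lemma Fan.Cw.sum {κ : Type} (S : Finset κ) (h : κ → ι → ℝ) (hh : ∀ k ∈ S, Φ.Cw (h k)) :
    Φ.Cw (∑ k ∈ S, h k) := by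
  classical
  induction S using Finset.induction_on with
  | empty => intro B hB j; simp
  | insert a S ha ih =>
    rw [Finset.sum_insert ha]
    exact (hh a (by simp)).add (ih fun k hk => hh k (by simp [hk]))

lemma Fan.C.sum {κ : Type} (S : Finset κ) (hS : S.Nonempty) (h : κ → ι → ℝ) (hh : ∀ k ∈ S, Φ.C (h k)) :
    Φ.C (∑ k ∈ S, h k) := by
  classical
  obtain ⟨a, ha⟩ := hS
  rw [← Finset.sum_erase_add _ _ ha]
  exact (Fan.Cw.sum _ _ fun k hk => (hh k (Finset.mem_of_mem_erase hk)).w).add_C (hh a ha)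

lemma Fan.P_convex (Φ : Fan n ι) (h : ι → ℝ) : Convex ℝ (Φ.P h) := by
  intro x hx y hy a b ha hb hab i
  simp only [dotProduct_add, dotProduct_smul, smul_eq_mul]
  calc a * (Φ.u i ⬝ᵥ x) + b * (Φ.u i ⬝ᵥ y) ≤ a * h i + b * h i :=
        add_le_add (mul_le_mul_of_nonneg_left (hx i) ha) (mul_le_mul_of_nonneg_left (hy i) hb)
    _ = h i := by rw [← add_mul, hab, one_mul]

lemma cont_dot (w : Fin n → ℝ) : Continuous (fun x : Fin n → ℝ => w ⬝ᵥ x) :=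
  continuous_const.dotProduct continuous_id

lemma Fan.P_closed (Φ : Fan n ι) (h : ι → ℝ) : IsClosed (Φ.P h) := by
  have : Φ.P h = ⋂ i, {x | Φ.u i ⬝ᵥ x ≤ h i} := by ext x; simp [Fan.P]
  rw [this]
  exact isClosed_iInter fun i => isClosed_le (cont_dot _) continuous_const

lemma Fan.P_bound (Φ : Fan n ι) (h : ι → ℝ) (w : Fin n → ℝ) : ∃ c, ∀ x ∈ Φ.P h, w ⬝ᵥ x ≤ c := by
  obtain ⟨B, hB, γ, hγ, hw⟩ := Φ.complete w
  refine ⟨∑ i ∈ B, γ i * h i, fun x hx => ?_⟩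
  rw [hw, Φ.dot_sum]
  exact Finset.sum_le_sum fun i hi => mul_le_mul_of_nonneg_left (hx i) (hγ i hi)

lemma Fan.P_compact (Φ : Fan n ι) (h : ι → ℝ) : IsCompact (Φ.P h) := by
  choose c hc using fun w => Φ.P_bound h w
  refine IsCompact.of_isClosed_subset (isCompact_Icc (a := fun k => - c (-Pi.single k 1))
    (b := fun k => c (Pi.single k 1))) (Φ.P_closed h) fun x hx => ⟨fun k => ?_, fun k => ?_⟩
  · have := hc (-Pi.single k 1) x hx
    simp only [neg_dotProduct, single_one_dotProduct] at this
    linarith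
  · have := hc (Pi.single k 1) x hx
    simpa using this

lemma Fan.X_mem {h : ι → ℝ} (hh : Φ.Cw h) {B} (hB : B ∈ Φ.Bs) : Φ.X B h ∈ Φ.P h := hh B hB

lemma Fan.P_hull {h : ι → ℝ} (hh : Φ.Cw h) :
    Φ.P h = convexHull ℝ ((fun B => Φ.X B h) '' (Φ.Bs : Set (Finset ι))) := by
  apply Set.Subset.antisymm
  · intro x hx
    by_contra hcon
    have hcl : IsClosed (convexHull ℝ ((fun B => Φ.X B h) '' (Φ.Bs : Set (Finset ι)))) :=
      (Set.Finite.isCompact_convexHull ℝ ((Finset.finite_toSet _).image _)).isClosed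
    obtain ⟨f, c, h1, h2⟩ := geometric_hahn_banach_closed_point (convex_convexHull ℝ _) hcl hcon
    have hf : ∀ z, f z = (fun k => f (Pi.single k 1)) ⬝ᵥ z := by
      intro z
      have : z = ∑ k, z k • (Pi.single k (1:ℝ) : Fin n → ℝ) := by
        ext j; simp [Finset.sum_apply, Pi.single_apply]
      conv_lhs => rw [this]
      simp only [map_sum, map_smul, dotProduct, smul_eq_mul]
      exact Finset.sum_congr rfl fun k _ => mul_comm _ _
    obtain ⟨B, hB, γ, hγ, hw⟩ := Φ.complete (fun k => f (Pi.single k 1))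
    have h3 := h1 (Φ.X B h) (subset_convexHull ℝ _ ⟨B, hB, rfl⟩)
    rw [hf, hw, Φ.dot_sum] at h2 h3
    have : ∑ i ∈ B, γ i * (Φ.u i ⬝ᵥ x) ≤ ∑ i ∈ B, γ i * (Φ.u i ⬝ᵥ Φ.X B h) :=
      Finset.sum_le_sum fun i hi => by
        rw [Φ.hX B hB h i hi]
        exact mul_le_mul_of_nonneg_left (hx i) (hγ i hi)
    linarith
  · apply convexHull_min _ (Φ.P_convex h)
    rintro _ ⟨B, hB, rfl⟩
    exact Fan.X_mem hh hB

lemma Fan.P_add {h h' : ι → ℝ} (hh : Φ.Cw h) (hh' : Φ.Cw h') : Φ.P (h + h') = Φ.P h + Φ.P h' := by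
  apply Set.Subset.antisymm
  · rw [Fan.P_hull (hh.add hh')]
    apply convexHull_min _ ((Φ.P_convex h).add (Φ.P_convex h'))
    rintro _ ⟨B, hB, rfl⟩
    simp only [map_add]
    exact Set.add_mem_add (Fan.X_mem hh hB) (Fan.X_mem hh' hB)
  · rintro _ ⟨x, hx, y, hy, rfl⟩ i
    have := hx i
    have := hy i
    simp only [dotProduct_add, Pi.add_apply]; linarith

lemma Fan.P_zero (Φ : Fan n ι) : Φ.P 0 = {0} := by
  have h0 : Φ.Cw 0 := by intro B hB j; simp
  rw [Fan.P_hull h0]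
  obtain ⟨B, hB, _⟩ := Φ.complete 0
  have : ((fun B => Φ.X B (0 : ι → ℝ)) '' (Φ.Bs : Set (Finset ι))) = {0} := by
    ext x
    simp only [map_zero, Set.mem_image, Set.mem_singleton_iff]
    exact ⟨fun ⟨_, _, h⟩ => h.symm, fun h => ⟨B, hB, h.symm⟩⟩
  rw [this, convexHull_singleton]

lemma Fan.P_sum {κ : Type} (S : Finset κ) (h : κ → ι → ℝ) (hh : ∀ k ∈ S, Φ.Cw (h k)) :
    Φ.P (∑ k ∈ S, h k) = ∑ k ∈ S, Φ.P (h k) := by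
  classical
  induction S using Finset.induction_on with
  | empty => simp [Fan.P_zero]; rfl
  | insert a S ha ih =>
    rw [Finset.sum_insert ha, Finset.sum_insert ha, Fan.P_add (hh a (by simp))
      (Fan.Cw.sum _ _ fun k hk => hh k (by simp [hk])), ih fun k hk => hh k (by simp [hk])]

/-- tight constraints form a face -/
lemma Fan.tight {h : ι → ℝ} (hh : Φ.C h) {x} (hx : x ∈ Φ.P h) {σ : Finset ι}
    (hσ : ∀ i ∈ σ, Φ.u i ⬝ᵥ x = h i) : Φ.Face σ := by
  by_contra hcon
  have hB : ∀ B ∈ Φ.Bs, (∑ i ∈ σ, Φ.u i) ⬝ᵥ Φ.X B h < ∑ i ∈ σ, h i := by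
    intro B hB
    rw [sum_dotProduct]
    apply Finset.sum_lt_sum
    · intro i _; exact hh.le hB i
    · by_contra hc
      push Not at hc
      refine hcon ⟨B, hB, fun i hi => ?_⟩
      by_contra hiB
      exact absurd (hh B hB i hiB) (not_lt.2 (hc i hi))
  rw [Fan.P_hull hh.w] at hx
  have hsub : convexHull ℝ ((fun B => Φ.X B h) '' (Φ.Bs : Set (Finset ι))) ⊆
      {x | (∑ i ∈ σ, Φ.u i) ⬝ᵥ x < ∑ i ∈ σ, h i} := by
    apply convexHull_min
    · rintro _ ⟨B, hB', rfl⟩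
      exact hB B hB'
    · intro x hx y hy a b ha hb hab
      simp only [Set.mem_ofPred_eq, dotProduct_add, dotProduct_smul, smul_eq_mul] at *
      rcases ha.lt_or_eq with ha | ha
      · nlinarith [mul_lt_mul_of_pos_left hx ha, mul_le_mul_of_nonneg_left hy.le hb,
          congrArg (fun t => t * ∑ i ∈ σ, h i) hab]
      · have : b = 1 := by linarith
        rw [← ha, this]; linarith
  have := hsub hx
  simp only [Set.mem_ofPred_eq, sum_dotProduct] at this
  rw [Finset.sum_congr rfl hσ] at this
  exact lt_irrefl _ this

/-- volume function -/
noncomputable def Fan.g (Φ : Fan n ι) (h : ι → ℝ) : ℝ := vol (Φ.P h)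

lemma Fan.g_trans (Φ : Fan n ι) (h : ι → ℝ) (y) : Φ.g (h + Φ.τ y) = Φ.g h := by
  have : Φ.P (h + Φ.τ y) = (fun x => y + x) '' Φ.P h := by
    ext x
    simp only [Set.mem_image]
    constructor
    · intro hx
      refine ⟨x - y, fun i => ?_, by simp⟩
      have := hx i
      simp only [Pi.add_apply, Fan.τ] at this
      rw [dotProduct_sub]; linarith
    · rintro ⟨z, hz, rfl⟩ i
      have := hz i
      simp only [Pi.add_apply, Fan.τ, dotProduct_add]; linarith
  rw [Fan.g, Fan.g, this, vol, vol, Set.image_add_left, measure_preimage_add]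

lemma Fan.g_smul (Φ : Fan n ι) (h : ι → ℝ) {c : ℝ} (hc : 0 < c) : Φ.g (c • h) = c ^ n * Φ.g h := by
  have : Φ.P (c • h) = c • Φ.P h := by
    ext x
    rw [Set.mem_smul_set_iff_inv_smul_mem₀ hc.ne']
    simp only [Fan.P, Set.mem_ofPred_eq, dotProduct_smul, Pi.smul_apply, smul_eq_mul]
    exact forall_congr' fun i => (inv_mul_le_iff₀ hc).symm
  rw [Fan.g, Fan.g, this, vol, vol, Measure.addHaar_smul]
  simp [abs_of_pos hc, ENNReal.toReal_mul, ENNReal.toReal_ofReal, hc.le]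

end
end AFI

namespace AFI
open Filter

/-- iterated difference -/
noncomputable def D {E : Type} [AddCommMonoid E] (f : E → ℝ) (s : Multiset E) (Z : E) : ℝ :=
  (s.powerset.map fun T => (-1 : ℝ) ^ (Multiset.card s + Multiset.card T) * f (Z + T.sum)).sum

section
variable {E : Type} [AddCommMonoid E] (f : E → ℝ)

lemma D_zero (Z : E) : D f 0 Z = f Z := by simp [D]

lemma D_cons (a : E) (s : Multiset E) (Z : E) : D f (a ::ₘ s) Z = D f s (Z + a) - D f s Z := by
  simp only [D, Multiset.powerset_cons, Multiset.map_add, Multiset.sum_add, Multiset.map_map,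
    Function.comp_def, Multiset.card_cons, Multiset.sum_cons]
  have e1 : ∀ T : Multiset E, (-1:ℝ) ^ (Multiset.card s + 1 + Multiset.card T) * f (Z + T.sum) =
      - ((-1:ℝ) ^ (Multiset.card s + Multiset.card T) * f (Z + T.sum)) := by
    intro T; ring
  have e2 : ∀ T : Multiset E, (-1:ℝ) ^ (Multiset.card s + 1 + (Multiset.card T + 1)) * f (Z + (a + T.sum)) =
      ((-1:ℝ) ^ (Multiset.card s + Multiset.card T) * f (Z + a + T.sum)) := by
    intro T; rw [← add_assoc Z]; ring
  have e3 : ∀ (w : Multiset E → ℝ) (t : Multiset (Multiset E)),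
      (t.map fun x => - w x).sum = - (t.map w).sum := fun w t => by
    induction t using Multiset.induction_on with
    | empty => simp
    | cons a t ih => simp only [Multiset.map_cons, Multiset.sum_cons, ih]; ring
  simp only [e1, e2]
  rw [e3]
  ring

lemma D_finset {κ : Type} [DecidableEq κ] (h : κ → E) (σ : Finset κ) (Z : E) :
    D f (σ.val.map h) Z = ∑ S ∈ σ.powerset, (-1 : ℝ) ^ (σ.card + S.card) * f (Z + ∑ k ∈ S, h k) := by
  induction σ using Finset.induction_on generalizing Z with
  | empty => simp [D_zero]
  | insert k σ hk ih =>
    rw [Finset.insert_val_of_notMem hk, Multiset.map_cons, D_cons, ih, ih,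
      Finset.sum_powerset_insert hk, Finset.card_insert_of_notMem hk, sub_eq_neg_add,
      ← Finset.sum_neg_distrib]
    congr 1
    · exact Finset.sum_congr rfl fun S _ => by ring
    · refine Finset.sum_congr rfl fun S hS => ?_
      have hkS : k ∉ S := fun h => hk (Finset.mem_powerset.1 hS h)
      rw [Finset.sum_insert hkS, Finset.card_insert_of_notMem hkS, add_assoc Z]; ring

lemma D_add (a b : E) (s : Multiset E) (Z : E) :
    D f ((a + b) ::ₘ s) Z = D f (a ::ₘ s) Z + D f (b ::ₘ s) (Z + a) := by
  rw [D_cons, D_cons, D_cons, add_assoc]; ring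

end

section
variable {n : ℕ} {ι : Type} [Fintype ι] [DecidableEq ι] {Φ : Fan n ι}

/-- regions -/
def Fan.Reg (Φ : Fan n ι) (σ : Finset ι) (c Z : ι → ℝ) : Set (Fin n → ℝ) :=
  {x | (∀ i, i ∉ σ → Φ.u i ⬝ᵥ x ≤ Z i) ∧ ∀ i ∈ σ, Z i < Φ.u i ⬝ᵥ x ∧ Φ.u i ⬝ᵥ x ≤ Z i + c i}

lemma Fan.Reg_meas (Φ : Fan n ι) (σ : Finset ι) (c Z : ι → ℝ) : MeasurableSet (Φ.Reg σ c Z) := by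
  have : Φ.Reg σ c Z = (⋂ i, ⋂ (_ : i ∉ σ), {x | Φ.u i ⬝ᵥ x ≤ Z i}) ∩
      (⋂ i, ⋂ (_ : i ∈ σ), {x | Z i < Φ.u i ⬝ᵥ x} ∩ {x | Φ.u i ⬝ᵥ x ≤ Z i + c i}) := by
    ext x; simp [Fan.Reg]
  rw [this]
  have hm := fun i => (cont_dot (Φ.u i)).measurable
  refine MeasurableSet.inter ?_ ?_
  · exact MeasurableSet.iInter fun i => MeasurableSet.iInter fun _ =>
      measurableSet_le (hm i) measurable_const
  · exact MeasurableSet.iInter fun i => MeasurableSet.iInter fun _ =>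
      (measurableSet_lt measurable_const (hm i)).inter (measurableSet_le (hm i) measurable_const)

lemma Fan.Reg_fin (Φ : Fan n ι) (σ : Finset ι) (c Z : ι → ℝ) : volume (Φ.Reg σ c Z) ≠ ⊤ := by
  have : Φ.Reg σ c Z ⊆ Φ.P (fun i => if i ∈ σ then Z i + c i else Z i) := by
    intro x hx i
    by_cases hi : i ∈ σ
    · simp only [hi, if_true]; exact (hx.2 i hi).2
    · simp only [hi, if_false]; exact hx.1 i hi
  exact ((measure_mono this).trans_lt (Φ.P_compact _).measure_lt_top).ne

lemma Fan.D_Reg (Φ : Fan n ι) (σ : Finset ι) (c Z : ι → ℝ) (hc : ∀ i, 0 ≤ c i) :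
    D Φ.g (σ.val.map fun i => c i • Pi.single i (1:ℝ)) Z = vol (Φ.Reg σ c Z) := by
  induction σ using Finset.induction_on generalizing Z with
  | empty => simp [D_zero, Fan.g, Fan.P, Fan.Reg]
  | insert k σ hk ih =>
    rw [Finset.insert_val_of_notMem hk, Multiset.map_cons, D_cons, ih, ih]
    have hne : ∀ i, i ≠ k → (Z + c k • (Pi.single k (1:ℝ) : ι → ℝ)) i = Z i := by
      intro i hi; simp [hi]
    have hk' : (Z + c k • (Pi.single k (1:ℝ) : ι → ℝ)) k = Z k + c k := by simp
    have hsub : Φ.Reg σ c Z ⊆ Φ.Reg σ c (Z + c k • (Pi.single k (1:ℝ) : ι → ℝ)) := by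
      rintro x ⟨h1, h2⟩
      refine ⟨fun i hi => ?_, fun i hi => ?_⟩
      · by_cases h : i = k
        · subst h; rw [hk']; linarith [h1 i hi, hc i]
        · rw [hne i h]; exact h1 i hi
      · rw [hne i (fun h => hk (h ▸ hi))]; exact h2 i hi
    have hdiff : Φ.Reg (insert k σ) c Z = Φ.Reg σ c (Z + c k • (Pi.single k (1:ℝ) : ι → ℝ)) \ Φ.Reg σ c Z := by
      ext x
      constructor
      · rintro ⟨h1, h2⟩
        refine ⟨⟨fun i hi => ?_, fun i hi => ?_⟩, fun h => ?_⟩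
        · by_cases h : i = k
          · subst h; rw [hk']; exact (h2 i (by simp)).2
          · rw [hne i h]; exact h1 i (by simp [h, hi])
        · rw [hne i (fun h => hk (h ▸ hi))]; exact h2 i (by simp [hi])
        · exact absurd (h2 k (by simp)).1 (not_lt.2 (h.1 k hk))
      · rintro ⟨⟨h1, h2⟩, h3⟩
        have h4 : ∀ i ∈ σ, Z i < Φ.u i ⬝ᵥ x ∧ Φ.u i ⬝ᵥ x ≤ Z i + c i := by
          intro i hi
          have := h2 i hi
          rwa [hne i (fun h => hk (h ▸ hi))] at this
        have h5 : ∀ i, i ∉ insert k σ → Φ.u i ⬝ᵥ x ≤ Z i := by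
          intro i hi
          simp only [Finset.mem_insert, not_or] at hi
          have := h1 i hi.2
          rwa [hne i hi.1] at this
        refine ⟨h5, fun i hi => ?_⟩
        rcases Finset.mem_insert.1 hi with rfl | hi
        · refine ⟨?_, by have := h1 i hk; rwa [hk'] at this⟩
          by_contra hcon
          push Not at hcon
          refine h3 ⟨fun j hj => ?_, h4⟩
          by_cases h : j = i
          · rw [h]; exact hcon
          · exact h5 j (by simp [h, hj])
        · exact h4 i hi
    rw [hdiff, vol, vol, vol, measure_sdiff hsub (Φ.Reg_meas _ _ _).nullMeasurableSet (Φ.Reg_fin _ _ _),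
      ENNReal.toReal_sub_of_le (measure_mono hsub) (Φ.Reg_fin _ _ _)]

lemma Fan.sep (Φ : Fan n ι) {B} (hB : B ∈ Φ.Bs) (x : Fin n → ℝ) (hx : ∀ i ∈ B, Φ.u i ⬝ᵥ x = 0) :
    x = 0 := by
  obtain ⟨γ, hγ⟩ := Φ.span B hB x
  have : x ⬝ᵥ x = 0 := by
    nth_rewrite 1 [hγ]
    rw [Φ.dot_sum]
    exact Finset.sum_eq_zero fun i hi => by rw [hx i hi, mul_zero]
  exact dotProduct_self_eq_zero.1 this

lemma Fan.box (Φ : Fan n ι) {B} (hB : B ∈ Φ.Bs) : ∃ w : ℝ, 0 < w ∧ ∀ c Z : ι → ℝ, (∀ i, 0 ≤ c i) →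
    vol {x | ∀ i ∈ B, Z i < Φ.u i ⬝ᵥ x ∧ Φ.u i ⬝ᵥ x ≤ Z i + c i} = (∏ i ∈ B, c i) * w := by
  let e := B.equivFinOfCardEq (Φ.card_eq B hB)
  let L : (Fin n → ℝ) →ₗ[ℝ] (Fin n → ℝ) := Matrix.toLin' (Matrix.of fun k => Φ.u (e.symm k).1)
  have hL : ∀ x k, L x k = Φ.u (e.symm k).1 ⬝ᵥ x := fun x k => rfl
  have hinj : Function.Injective L := by
    rw [← LinearMap.ker_eq_bot, LinearMap.ker_eq_bot']
    intro x hx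
    refine Φ.sep hB x fun i hi => ?_
    have := congrFun hx (e ⟨i, hi⟩)
    rw [hL] at this
    simpa using this
  have hdet : LinearMap.det L ≠ 0 := by
    intro h
    have := LinearMap.bot_lt_ker_of_det_eq_zero h
    rw [LinearMap.ker_eq_bot.2 hinj] at this
    exact lt_irrefl _ this
  refine ⟨|(LinearMap.det L)⁻¹|, by positivity, fun c Z hc => ?_⟩
  have hset : {x | ∀ i ∈ B, Z i < Φ.u i ⬝ᵥ x ∧ Φ.u i ⬝ᵥ x ≤ Z i + c i} = L ⁻¹' (Set.pi Set.univ
      fun k => Set.Ioc (Z (e.symm k).1) (Z (e.symm k).1 + c (e.symm k).1)) := by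
    ext x
    simp only [Set.mem_ofPred_eq, Set.mem_preimage, Set.mem_pi, Set.mem_univ, true_imp_iff, Set.mem_Ioc, hL]
    constructor
    · intro h k; exact h _ (e.symm k).2
    · intro h i hi
      have := h (e ⟨i, hi⟩)
      simpa using this
  rw [vol, hset, Measure.addHaar_preimage_linearMap _ hdet, ENNReal.toReal_mul,
    ENNReal.toReal_ofReal (abs_nonneg _), Real.volume_pi_Ioc_toReal, mul_comm]
  · congr 1
    simp only [add_sub_cancel_left]
    rw [Equiv.prod_comp e.symm (fun i : B => c i.1), Finset.prod_coe_sort B c]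
  · intro k; simp only; linarith [hc (e.symm k).1]

lemma Fan.C_ev {z : ι → ℝ} (hz : Φ.C z) (b : ι → ℝ) (R : ℝ) :
    ∀ᶠ l : ℝ in atTop, ∀ h : ι → ℝ, (∀ i, |h i - (l • z + b) i| ≤ R) → Φ.C h := by
  have key : ∀ B ∈ Φ.Bs, ∀ j, ∀ᶠ l : ℝ in atTop, j ∉ B → ∀ h : ι → ℝ, (∀ i, |h i - (l • z + b) i| ≤ R) →
      Φ.u j ⬝ᵥ Φ.X B h < h j := by
    intro B hB j
    by_cases hj : j ∈ B
    · exact Eventually.of_forall fun l h => absurd hj h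
    let N : (ι → ℝ) → ℝ := fun h => h j - Φ.u j ⬝ᵥ Φ.X B h
    have hcont : Continuous N :=
      (continuous_apply j).sub ((cont_dot _).comp (Φ.X B).continuous_of_finiteDimensional)
    obtain ⟨M, hM⟩ := (isCompact_Icc (a := fun i => b i - R) (b := fun i => b i + R)).bddBelow_image
      hcont.continuousOn
    have hNz : 0 < N z := by have := hz B hB j hj; simp only [N]; linarith
    filter_upwards [eventually_gt_atTop (-M / N z)] with l hl _ h hh
    have h1 : N h = l * N z + N (h - l • z) := by
      simp only [N, map_sub, map_smul, dotProduct_sub, dotProduct_smul, Pi.sub_apply, Pi.smul_apply,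
        smul_eq_mul]; ring
    have h2 : M ≤ N (h - l • z) := by
      refine hM ⟨_, ⟨fun i => ?_, fun i => ?_⟩, rfl⟩
      · have := (abs_le.1 (hh i)).1
        simp only [Pi.add_apply, Pi.smul_apply, Pi.sub_apply] at *; linarith
      · have := (abs_le.1 (hh i)).2
        simp only [Pi.add_apply, Pi.smul_apply, Pi.sub_apply] at *; linarith
    have h3 : -M < l * N z := by rwa [div_lt_iff₀ hNz] at hl
    have h4 : 0 < N h := by rw [h1]; linarith
    simp only [N] at h4; linarith
  have key2 : ∀ᶠ l : ℝ in atTop, ∀ B ∈ Φ.Bs, ∀ j, j ∉ B → ∀ h : ι → ℝ,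
      (∀ i, |h i - (l • z + b) i| ≤ R) → Φ.u j ⬝ᵥ Φ.X B h < h j := by
    rw [Finset.eventually_all]
    intro B hB
    rw [eventually_all]
    exact key B hB
  filter_upwards [key2] with l hl h hh B hB j hj
  exact hl B hB j hj h hh

/-- eventual constancy of the iterated difference -/
def Fan.K (Φ : Fan n ι) (s : Multiset (ι → ℝ)) (v : ℝ) : Prop :=
  ∀ z, Φ.C z → ∀ b, ∀ᶠ l : ℝ in atTop, D Φ.g s (l • z + b) = v

lemma Fan.K.cons {s v} (h : Φ.K s v) (a) : Φ.K (a ::ₘ s) 0 := by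
  intro z hz b
  filter_upwards [h z hz b, h z hz (b + a)] with l h1 h2
  rw [D_cons, h1, add_assoc, h2, sub_self]

lemma Fan.K.add {s a b va vb} (ha : Φ.K (a ::ₘ s) va) (hb : Φ.K (b ::ₘ s) vb) :
    Φ.K ((a + b) ::ₘ s) (va + vb) := by
  intro z hz b0
  filter_upwards [ha z hz b0, hb z hz (b0 + a)] with l h1 h2
  rw [D_add, h1, add_assoc, h2]

lemma Fan.K.neg {s a v} (ha : Φ.K (a ::ₘ s) v) : Φ.K ((-a) ::ₘ s) (-v) := by
  intro z hz b0
  filter_upwards [ha z hz (b0 - a)] with l h1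
  rw [D_cons, ← h1, D_cons]
  have : l • z + (b0 - a) + a = l • z + b0 := by abel
  rw [this, add_assoc, ← sub_eq_add_neg]; ring

lemma Fan.K_zero (s) : Φ.K (0 ::ₘ s) 0 := by
  intro z hz b0
  exact Eventually.of_forall fun l => by rw [D_cons, add_zero, sub_self]

lemma Fan.K_τ (y s) : Φ.K (Φ.τ y ::ₘ s) 0 := by
  intro z hz b0
  refine Eventually.of_forall fun l => ?_
  rw [D_cons, sub_eq_zero]
  simp only [D]
  congr 2
  ext T
  rw [add_right_comm, Φ.g_trans]

lemma Fan.K_sum {κ : Type} (S : Finset κ) (a : κ → ι → ℝ) (v : κ → ℝ) (s)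
    (h : ∀ k ∈ S, Φ.K (a k ::ₘ s) (v k)) : Φ.K ((∑ k ∈ S, a k) ::ₘ s) (∑ k ∈ S, v k) := by
  classical
  induction S using Finset.induction_on with
  | empty => simpa using Fan.K_zero s
  | insert k S hk ih =>
    rw [Finset.sum_insert hk, Finset.sum_insert hk]
    exact (h k (by simp)).add (ih fun j hj => h j (by simp [hj]))

lemma Fan.K.unique {z} (hz : Φ.C z) {s v v'} (h : Φ.K s v) (h' : Φ.K s v') : v = v' := by
  obtain ⟨l, h1, h2⟩ := ((h z hz 0).and (h' z hz 0)).exists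
  exact h1.symm.trans h2

lemma Fan.K_non {σ : Finset ι} (hσ : ¬ Φ.Face σ) (c : ι → ℝ) (hc : ∀ i, 0 ≤ c i) :
    Φ.K (σ.val.map fun i => c i • Pi.single i (1:ℝ)) 0 := by
  intro z hz b
  filter_upwards [Fan.C_ev hz b (∑ i, c i)] with l hl
  rw [Φ.D_Reg _ _ _ hc]
  have : Φ.Reg σ c (l • z + b) = ∅ := by
    rw [Set.eq_empty_iff_forall_notMem]
    rintro x ⟨h1, h2⟩
    set Z := l • z + b with hZ
    have hC := hl (fun i => if i ∈ σ then Φ.u i ⬝ᵥ x else Z i) (fun i => by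
      have hci : c i ≤ ∑ i, c i := Finset.single_le_sum (fun i _ => hc i) (Finset.mem_univ i)
      by_cases hi : i ∈ σ
      · simp only [hi, if_true]
        rw [abs_le]; constructor <;> linarith [(h2 i hi).1, (h2 i hi).2, hc i]
      · simp only [hi, if_false]; simpa using Finset.sum_nonneg fun i _ => hc i)
    refine hσ (Fan.tight hC (x := x) (fun i => ?_) (σ := σ) (fun i hi => by simp [hi]))
    by_cases hi : i ∈ σ
    · simp [hi]
    · simp only [hi, if_false]; exact h1 i hi
  rw [this]; simp [vol]

lemma Fan.K_box {B : Finset ι} (hB : B ∈ Φ.Bs) : ∃ w : ℝ, 0 < w ∧ ∀ (c : ι → ℝ), (∀ i, 0 ≤ c i) →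
    Φ.K (B.val.map fun i => c i • Pi.single i (1:ℝ)) ((∏ i ∈ B, c i) * w) := by
  obtain ⟨w, hw, hbox⟩ := Φ.box hB
  refine ⟨w, hw, fun c hc z hz b => ?_⟩
  filter_upwards [Fan.C_ev hz b (∑ i, c i)] with l hl
  rw [Φ.D_Reg _ _ _ hc, ← hbox c (l • z + b) hc]
  congr 1
  ext x
  refine ⟨fun h => h.2, fun h2 => ⟨fun j hj => ?_, h2⟩⟩
  replace h2 : ∀ i ∈ B, (l • z + b) i < Φ.u i ⬝ᵥ x ∧ Φ.u i ⬝ᵥ x ≤ (l • z + b) i + c i := h2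
  set Z := l • z + b with hZ
  set h' : ι → ℝ := fun i => if i ∈ B then Φ.u i ⬝ᵥ x else Z i with hh'
  have hC := hl h' (fun i => by
    have hci : c i ≤ ∑ i, c i := Finset.single_le_sum (fun i _ => hc i) (Finset.mem_univ i)
    by_cases hi : i ∈ B
    · simp only [hh', hi, if_true]
      rw [abs_le]; constructor <;> linarith [(h2 i hi).1, (h2 i hi).2, hc i]
    · simp only [hh', hi, if_false]; simpa using Finset.sum_nonneg fun i _ => hc i)
  have hx : Φ.X B h' = x := by
    rw [← sub_eq_zero]
    refine Φ.sep hB _ fun i hi => ?_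
    rw [dotProduct_sub, Φ.hX B hB _ i hi]
    simp [hh', hi]
  have := hC.le hB j
  rw [hx] at this
  simpa [hh', hj] using this

end
end AFI

namespace AFI
open Filter

section
variable {n : ℕ} {ι : Type} [Fintype ι] [DecidableEq ι] {Φ : Fan n ι}

/-- scaled unit vectors over a set -/
def sq (σ : Finset ι) (c : ι → ℝ) : Multiset (ι → ℝ) := σ.val.map fun i => c i • Pi.single i (1:ℝ)

/-- scaled unit vectors over a multiset -/
def vec (p : Multiset (ℝ × ι)) : Multiset (ι → ℝ) := p.map fun x => x.1 • Pi.single x.2 (1:ℝ)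

lemma sq_insert {σ : Finset ι} {k : ι} (hk : k ∉ σ) (c : ι → ℝ) :
    sq (insert k σ) c = (c k • Pi.single k (1:ℝ)) ::ₘ sq σ c := by
  rw [sq, Finset.insert_val_of_notMem hk, Multiset.map_cons]; rfl

lemma sq_congr {σ : Finset ι} {c c' : ι → ℝ} (h : ∀ i ∈ σ, c i = c' i) : sq σ c = sq σ c' :=
  Multiset.map_congr rfl fun i hi => by rw [h i hi]

lemma Fan.K_sign (σ : Finset ι) (v : ℝ)
    (h : ∀ c : ι → ℝ, (∀ i, 0 ≤ c i) → Φ.K (sq σ c) ((∏ i ∈ σ, c i) * v)) (c : ι → ℝ) :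
    Φ.K (sq σ c) ((∏ i ∈ σ, c i) * v) := by
  have key : ∀ ρ : Finset ι, ∀ c : ι → ℝ, (∀ i, i ∉ ρ → 0 ≤ c i) →
      Φ.K (sq σ c) ((∏ i ∈ σ, c i) * v) := by
    intro ρ
    induction ρ using Finset.induction_on with
    | empty => intro c hc; exact h c fun i => hc i (by simp)
    | insert k ρ hk ih =>
      intro c hc
      by_cases hck : 0 ≤ c k
      · refine ih c fun i hi => ?_
        by_cases hik : i = k
        · rw [hik]; exact hck
        · exact hc i (by simp [hik, hi])
      push Not at hck
      have h1 := ih (Function.update c k (- c k)) (fun i hi => by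
        by_cases hik : i = k
        · rw [hik]; simp; exact hck.le
        · rw [Function.update_of_ne hik]; exact hc i (by simp [hik, hi]))
      by_cases hkσ : k ∈ σ
      · have e : σ = insert k (σ.erase k) := (Finset.insert_erase hkσ).symm
        have hne : ∀ i ∈ σ.erase k, Function.update c k (- c k) i = c i := fun i hi =>
          Function.update_of_ne (Finset.ne_of_mem_erase hi) _ _
        rw [e] at h1 ⊢
        rw [sq_insert (Finset.notMem_erase k σ), sq_congr hne, Finset.prod_insert (Finset.notMem_erase k σ),
          Finset.prod_congr rfl hne, Function.update_self] at h1
        rw [sq_insert (Finset.notMem_erase k σ), Finset.prod_insert (Finset.notMem_erase k σ)]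
        have h2 := h1.neg
        rw [neg_smul, neg_neg] at h2
        convert h2 using 1
        ring
      · have hne : ∀ i ∈ σ, Function.update c k (- c k) i = c i := fun i hi =>
          Function.update_of_ne (fun h : i = k => hkσ (h ▸ hi)) _ _
        rwa [sq_congr hne, Finset.prod_congr rfl hne] at h1
  exact key Finset.univ c (by simp)

lemma Fan.K.add_multi {s} (h : Φ.K s 0) (t) : Φ.K (t + s) 0 := by
  induction t using Multiset.induction_on with
  | empty => simpa using h
  | cons a t ih => rw [Multiset.cons_add]; exact ih.cons a

lemma Fan.K_nonface {σ : Finset ι} (hσ : ¬ Φ.Face σ) (c : ι → ℝ) (t) : Φ.K (t + sq σ c) 0 := by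
  have := Fan.K_sign (Φ := Φ) σ 0 (fun c hc => by rw [mul_zero]; exact Fan.K_non hσ c hc) c
  rw [mul_zero] at this
  exact this.add_multi t

lemma single_sum (h : ι → ℝ) : h = ∑ i, h i • (Pi.single i (1:ℝ) : ι → ℝ) := by
  ext j; simp [Finset.sum_apply, Pi.single_apply]

lemma Fan.K_move (k : ℕ) : ∀ (σ : Finset ι) (q : Multiset ι), Multiset.card q = k → σ.card + k = n →
    ∃ v : ℝ, ∀ (c : ι → ℝ) (p : Multiset (ℝ × ι)), p.map Prod.snd = q →
      Φ.K (vec p + sq σ c) ((p.map Prod.fst).prod * (∏ i ∈ σ, c i) * v) := by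
  induction k with
  | zero =>
    intro σ q hq hσ
    rw [Multiset.card_eq_zero] at hq
    subst hq
    have : ∃ v : ℝ, ∀ c : ι → ℝ, Φ.K (sq σ c) ((∏ i ∈ σ, c i) * v) := by
      by_cases hf : Φ.Face σ
      · obtain ⟨B, hB, hs⟩ := hf
        have : σ = B := Finset.eq_of_subset_of_card_le hs (by rw [Φ.card_eq B hB]; omega)
        subst this
        obtain ⟨w, -, hw⟩ := Fan.K_box hB
        exact ⟨w, Fan.K_sign σ w hw⟩
      · exact ⟨0, fun c => by simpa using Fan.K_nonface hf c 0⟩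
    obtain ⟨v, hv⟩ := this
    refine ⟨v, fun c p hp => ?_⟩
    rw [Multiset.map_eq_zero] at hp
    subst hp
    simpa [vec] using hv c
  | succ k ih =>
    intro σ q hq hσ
    by_cases hf : Φ.Face σ
    swap
    · exact ⟨0, fun c p _ => by rw [mul_zero]; exact Fan.K_nonface hf c _⟩
    obtain ⟨B, hB, hs⟩ := hf
    obtain ⟨i, hi⟩ := Multiset.card_pos_iff_exists_mem.1 (by omega : 0 < Multiset.card q)
    obtain ⟨q', rfl⟩ := Multiset.exists_cons_of_mem hi
    rw [Multiset.card_cons] at hq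
    have ih' := fun (l : {l // l ∉ σ}) => ih (insert l.1 σ) q' (by omega) (by
      rw [Finset.card_insert_of_notMem l.2]; omega)
    choose v hv using ih'
    set y := Φ.X B (Pi.single i 1) with hy
    set d : ι → ℝ := Pi.single i 1 - Φ.τ y with hd
    have hdσ : ∀ l ∈ σ, d l = 0 := by
      intro l hl
      simp only [hd, Pi.sub_apply, Fan.τ, hy]
      rw [Φ.hX B hB _ l (hs hl), sub_self]
    refine ⟨∑ l : {l // l ∉ σ}, d l.1 * v l, fun c p hp => ?_⟩
    obtain ⟨⟨a, j⟩, hm, hj, hp'⟩ := (Multiset.map_eq_cons _ _ _ _).2 hp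
    replace hj : j = i := hj
    subst j
    obtain ⟨p', rfl⟩ := Multiset.exists_cons_of_mem hm
    rw [Multiset.erase_cons_head] at hp'
    have e1 : vec ((a, i) ::ₘ p') + sq σ c = (a • Pi.single i (1:ℝ)) ::ₘ (vec p' + sq σ c) := by
      simp [vec]
    have e2 : a • (Pi.single i (1:ℝ) : ι → ℝ) = Φ.τ (a • y) +
        ∑ l : {l // l ∉ σ}, (a * d l.1) • (Pi.single l.1 (1:ℝ) : ι → ℝ) := by
      have hτ : Φ.τ (a • y) = a • Φ.τ y := by ext; simp [Fan.τ]
      have h1 : d = ∑ l : {l // l ∉ σ}, d l.1 • (Pi.single l.1 (1:ℝ) : ι → ℝ) := by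
        rw [← Finset.sum_subtype (Finset.univ.filter fun l => l ∉ σ) (by simp)
          (fun l => d l • (Pi.single l (1:ℝ) : ι → ℝ))]
        conv_lhs => rw [single_sum d]
        symm
        apply Finset.sum_subset (by simp)
        intro l _ hl
        rw [hdσ l (by simpa using hl), zero_smul]
      simp only [mul_smul]
      rw [← Finset.smul_sum, ← h1, hτ, ← smul_add, hd]
      simp
    rw [e1, e2]
    have h3 := (Fan.K_τ (Φ := Φ) (a • y) (vec p' + sq σ c)).add (Fan.K_sum Finset.univ
      (fun l : {l // l ∉ σ} => (a * d l.1) • (Pi.single l.1 (1:ℝ) : ι → ℝ))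
      (fun l => (p'.map Prod.fst).prod * ((a * d l.1) * ∏ i ∈ σ, c i) * v l) (vec p' + sq σ c) (by
        intro l _
        have h4 := hv l (Function.update c l.1 (a * d l.1)) p' hp'
        have hne : ∀ i ∈ σ, Function.update c l.1 (a * d l.1) i = c i := fun i hi =>
          Function.update_of_ne (fun h : i = l.1 => l.2 (h ▸ hi)) _ _
        rw [sq_insert l.2, Finset.prod_insert l.2, sq_congr hne, Finset.prod_congr rfl hne,
          Function.update_self, Multiset.add_cons] at h4
        exact h4))
    convert h3 using 1
    rw [zero_add, Finset.mul_sum, Multiset.map_cons, Multiset.prod_cons]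
    exact Finset.sum_congr rfl fun l _ => by ring

lemma vec_cons (a : ℝ) (i : ι) (p) : vec ((a, i) ::ₘ p) = (a • Pi.single i (1:ℝ)) ::ₘ vec p := by
  simp [vec]

lemma Fan.K_ex (t : Multiset (ι → ℝ)) : ∀ p : Multiset (ℝ × ι), Multiset.card t + Multiset.card p = n →
    ∃ v, Φ.K (t + vec p) v := by
  induction t using Multiset.induction_on with
  | empty =>
    intro p hp
    obtain ⟨v, hv⟩ := Fan.K_move (Φ := Φ) n ∅ (p.map Prod.snd) (by simpa using hp) (by simp)
    exact ⟨_, by simpa [sq] using hv 0 p rfl⟩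
  | cons a t ih =>
    intro p hp
    rw [Multiset.card_cons] at hp
    have ih' := fun l : ι => ih ((a l, l) ::ₘ p) (by rw [Multiset.card_cons]; omega)
    choose v hv using ih'
    refine ⟨∑ l, v l, ?_⟩
    rw [Multiset.cons_add]
    conv_lhs => rw [single_sum a]
    refine Fan.K_sum _ _ _ _ fun l _ => ?_
    have := hv l
    rwa [vec_cons, Multiset.add_cons] at this

lemma Fan.K_hom0 {z} (hz : Φ.C z) (i : ι) (c : ℝ) (t : Multiset (ι → ℝ)) : ∀ (p : Multiset (ℝ × ι)) (v : ℝ),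
    Multiset.card t + Multiset.card p + 1 = n → Φ.K (Pi.single i 1 ::ₘ (t + vec p)) v →
    Φ.K ((c • Pi.single i 1) ::ₘ (t + vec p)) (c * v) := by
  induction t using Multiset.induction_on with
  | empty =>
    intro p v hp hK
    obtain ⟨w, hw⟩ := Fan.K_move (Φ := Φ) n ∅ (i ::ₘ p.map Prod.snd) (by simpa using hp) (by simp)
    have h1 := hw 0 ((1, i) ::ₘ p) (by simp)
    have h2 := hw 0 ((c, i) ::ₘ p) (by simp)
    rw [vec_cons, Multiset.cons_add] at h1 h2
    simp only [sq, Finset.empty_val, Multiset.map_zero, add_zero, zero_add, one_smul, Multiset.map_cons, Multiset.prod_cons, one_mul] at h1 h2 hK ⊢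
    have := hK.unique hz h1
    rw [this]
    convert h2 using 1
    ring
  | cons a t ih =>
    intro p v hp hK
    rw [Multiset.card_cons] at hp
    have hv : ∀ l : ι, ∃ v, Φ.K (Pi.single i 1 ::ₘ (t + vec ((a l, l) ::ₘ p))) v := fun l => by
      have := Fan.K_ex (Φ := Φ) (Pi.single i 1 ::ₘ t) ((a l, l) ::ₘ p)
        (by rw [Multiset.card_cons, Multiset.card_cons]; omega)
      rwa [Multiset.cons_add] at this
    choose w hw using hv
    have hw' := fun l => ih ((a l, l) ::ₘ p) (w l) (by rw [Multiset.card_cons]; omega) (hw l)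
    have e : ∀ b : ι → ℝ, ∀ f : ι → ℝ, (∀ l, Φ.K (b ::ₘ (t + vec ((a l, l) ::ₘ p))) (f l)) →
        Φ.K (b ::ₘ (a ::ₘ t + vec p)) (∑ l, f l) := by
      intro b f hf
      rw [Multiset.cons_add, Multiset.cons_swap]
      conv_lhs => rw [single_sum a]
      refine Fan.K_sum _ _ _ _ fun l _ => ?_
      have := hf l
      rwa [vec_cons, Multiset.add_cons, Multiset.cons_swap] at this
    have := hK.unique hz (e _ _ hw)
    rw [this, Finset.mul_sum]
    exact e _ _ hw'

lemma Fan.K.smul {z} (hz : Φ.C z) {a : ι → ℝ} {s v} (hs : Multiset.card s + 1 = n) (h : Φ.K (a ::ₘ s) v) (c : ℝ) :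
    Φ.K ((c • a) ::ₘ s) (c * v) := by
  have hw : ∀ l : ι, ∃ v, Φ.K (Pi.single l 1 ::ₘ s) v := fun l => by
    have := Fan.K_ex (Φ := Φ) (Pi.single l 1 ::ₘ s) 0 (by simpa using hs)
    simpa [vec] using this
  choose w hw using hw
  have e : ∀ b : ι → ℝ, Φ.K (b ::ₘ s) (∑ l, b l * w l) := by
    intro b
    conv_lhs => rw [single_sum b]
    refine Fan.K_sum _ _ _ _ fun l _ => ?_
    simpa [vec] using Fan.K_hom0 hz l (b l) s 0 (w l) (by simpa using hs) (by simpa [vec] using hw l)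
  rw [h.unique hz (e a), Finset.mul_sum]
  convert e (c • a) using 1
  exact Finset.sum_congr rfl fun l _ => by simp; ring

open Classical in
/-- the volume form -/
noncomputable def Fan.F (Φ : Fan n ι) (s : Multiset (ι → ℝ)) : ℝ :=
  if Multiset.card s = n then Classical.epsilon (Φ.K s) else 0

lemma Fan.F_K (Φ : Fan n ι) {s : Multiset (ι → ℝ)} (hs : Multiset.card s = n) : Φ.K s (Φ.F s) := by
  rw [Fan.F, if_pos hs]
  exact Classical.epsilon_spec (by simpa [vec] using Fan.K_ex (Φ := Φ) s 0 (by simpa using hs))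

lemma Fan.F_eq {z} (hz : Φ.C z) {s v} (hs : Multiset.card s = n) (h : Φ.K s v) : Φ.F s = v :=
  (Φ.F_K hs).unique hz h

lemma Fan.F_form {z} (hz : Φ.C z) : Form Φ Φ.F where
  add a b s := by
    by_cases hs : Multiset.card s + 1 = n
    · exact F_eq hz (by simpa using hs) ((Φ.F_K (by simpa using hs)).add (Φ.F_K (by simpa using hs)))
    · simp [Fan.F, hs]
  smul c a s := by
    by_cases hs : Multiset.card s + 1 = n
    · exact F_eq hz (by simpa using hs) ((Φ.F_K (by simpa using hs)).smul hz hs c)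
    · simp [Fan.F, hs]
  trans y s := by
    by_cases hs : Multiset.card s + 1 = n
    · exact F_eq hz (by simpa using hs) (K_τ y s)
    · simp [Fan.F, hs]
  non σ hσ s := by
    by_cases hs : Multiset.card (s + ev σ) = n
    · refine F_eq hz hs ?_
      have := K_nonface hσ (fun _ => 1) s
      simpa [sq, ev] using this
    · simp only [Fan.F, hs, if_false]
  pos B hB := by
    obtain ⟨w, hw, hK⟩ := K_box hB
    have := hK (fun _ => 1) (by simp)
    rw [F_eq hz (v := w) (by simp [ev, Φ.card_eq B hB]) (by simpa [ev] using this)]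
    exact hw

end
end AFI

namespace AFI
open Filter

section
variable {n : ℕ} {ι : Type} [Fintype ι] [DecidableEq ι] {Φ : Fan n ι}

lemma Fan.F_diag {z} (hz : Φ.C z) : Φ.F (Multiset.replicate n z) = n.factorial * Φ.g z := by
  have h1 : ∀ k : ℕ, ∀ l : ℝ, 0 < l → D Φ.g (Multiset.replicate k z) (l • z) =
      ((fwdDiff (1:ℝ))^[k] (Φ.g z • fun l : ℝ => l ^ n)) l := by
    intro k
    induction k with
    | zero => intro l hl; simp [D_zero, Φ.g_smul z hl, mul_comm]
    | succ k ih =>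
      intro l hl
      rw [Multiset.replicate_succ, D_cons, Function.iterate_succ_apply', fwdDiff, ih l hl,
        ← ih (l + 1) (by linarith), add_smul, one_smul]
  obtain ⟨l, h2, h3⟩ := ((Φ.F_K (s := Multiset.replicate n z) (by simp) z hz 0).and
    (eventually_gt_atTop 0)).exists
  rw [← h2, add_zero, h1 n l h3, fwdDiff_iter_const_smul, fwdDiff_iter_eq_factorial]
  simp [mul_comm]

lemma Form.poly {F : Multiset (ι → ℝ) → ℝ} (hF : Form Φ F) (z w : ι → ℝ) (k : ℕ) : ∀ s, ∃ p : Polynomial ℝ, ∀ l : ℝ,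
    F (Multiset.replicate k (l • z + w) + s) = p.eval l := by
  induction k with
  | zero => intro s; exact ⟨Polynomial.C (F s), fun l => by simp⟩
  | succ k ih =>
    intro s
    obtain ⟨p1, h1⟩ := ih (z ::ₘ s)
    obtain ⟨p2, h2⟩ := ih (w ::ₘ s)
    refine ⟨Polynomial.X * p1 + p2, fun l => ?_⟩
    rw [Multiset.replicate_succ, Multiset.cons_add, hF.add, hF.smul, ← Multiset.add_cons, ← Multiset.add_cons, h1, h2]
    simp

lemma Fan.F_MV (hn : 0 < n) (h : Fin n → ι → ℝ) (hh : ∀ j, Φ.C (h j)) :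
    Φ.F (Finset.univ.val.map h) = MV n (fun j => Φ.P (h j)) := by
  have hne : (Finset.univ : Finset (Fin n)).Nonempty := ⟨⟨0, hn⟩, Finset.mem_univ _⟩
  have hz : Φ.C (∑ j, h j) := Fan.C.sum _ hne h fun j _ => hh j
  set z := ∑ j, h j with hzdef
  have hF := Fan.F_form hz
  have hg0 : Φ.g 0 = 0 := by
    haveI : Nonempty (Fin n) := ⟨⟨0, hn⟩⟩
    rw [Fan.g, Φ.P_zero, vol]; simp
  have hF0 : Φ.F (Multiset.replicate n 0) = 0 := by
    obtain ⟨m, rfl⟩ : ∃ m, n = m + 1 := ⟨n - 1, by omega⟩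
    rw [Multiset.replicate_succ]
    have := hF.smul 0 0 (Multiset.replicate m 0)
    simpa using this
  choose p hp using fun S : Finset (Fin n) => hF.poly z (∑ j ∈ S, h j) n 0
  have h1 : ∀ l : ℝ, 0 ≤ l → ∀ S : Finset (Fin n),
      Φ.g (l • z + ∑ j ∈ S, h j) = (n.factorial : ℝ)⁻¹ * (p S).eval l := by
    intro l hl S
    have hfac : (n.factorial : ℝ) ≠ 0 := by positivity
    rw [← hp S l, add_zero]
    by_cases hC : 0 < l ∨ S.Nonempty
    · have : Φ.C (l • z + ∑ j ∈ S, h j) := by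
        rcases hC with hl' | hS
        · rw [add_comm]
          exact (Fan.Cw.sum S h fun j _ => (hh j).w).add_C (hz.smul hl')
        · rcases hl.eq_or_lt with rfl | hl'
          · rw [zero_smul, zero_add]; exact Fan.C.sum S hS h fun j _ => hh j
          · rw [add_comm]
            exact (Fan.Cw.sum S h fun j _ => (hh j).w).add_C (hz.smul hl')
      rw [Fan.F_diag this]; field_simp
    · push Not at hC
      obtain ⟨h2, h3⟩ := hC
      have : l = 0 := le_antisymm h2 hl
      rw [this, h3]
      simp [hg0, hF0]
  set Q : Polynomial ℝ := ∑ S ∈ (Finset.univ : Finset (Fin n)).powerset,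
    Polynomial.C ((-1 : ℝ) ^ ((Finset.univ : Finset (Fin n)).card + S.card) * (n.factorial : ℝ)⁻¹) * p S with hQ
  have h2 : ∀ l : ℝ, 0 ≤ l → D Φ.g (Finset.univ.val.map h) (l • z) = Q.eval l := by
    intro l hl
    rw [D_finset, hQ, Polynomial.eval_finset_sum]
    refine Finset.sum_congr rfl fun S _ => ?_
    rw [h1 l hl S, Polynomial.eval_mul, Polynomial.eval_C]; ring
  have h3 : Q = Polynomial.C (Φ.F (Finset.univ.val.map h)) := by
    apply Polynomial.eq_of_infinite_eval_eq
    have hev := (Φ.F_K (s := Finset.univ.val.map h) (by simp) z hz 0).and (eventually_ge_atTop 0)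
    obtain ⟨R, hR⟩ := eventually_atTop.1 hev
    refine Set.Infinite.mono ?_ (Set.Ici_infinite R)
    intro l hl
    have := hR l hl
    rw [add_zero, h2 l this.2] at this
    simpa using this.1
  have h4 : D Φ.g (Finset.univ.val.map h) 0 = Φ.F (Finset.univ.val.map h) := by
    have := h2 0 le_rfl
    rw [h3, zero_smul] at this
    simpa using this
  rw [← h4, D_finset, Finset.sum_powerset, Finset.card_univ, Fintype.card_fin, MV,
    Finset.range_eq_Ico, Finset.sum_eq_sum_Ico_succ_bot (by omega)]
  simp only [Finset.powersetCard_zero, Finset.sum_singleton, Finset.sum_empty, add_zero, zero_add, hg0, mul_zero]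
  refine Finset.sum_congr rfl fun j hj => ?_
  rw [Finset.mul_sum]
  have hj' : j ≤ n := by have := Finset.mem_Ico.1 hj; omega
  refine Finset.sum_congr rfl fun S hS => ?_
  rw [(Finset.mem_powersetCard.1 hS).2, Fan.g, Fan.P_sum S h fun k _ => (hh k).w]
  congr 1
  obtain ⟨d, rfl⟩ := Nat.exists_eq_add_of_le hj'
  rw [Nat.add_sub_cancel_left, show j + d + j = d + 2 * j by ring, pow_add, pow_mul]
  simp

end
end AFI

namespace AFI
open Filter Topology

section
variable {n : ℕ} {ι : Type} [Fintype ι] [DecidableEq ι]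

/-- polytopal fan data -/
structure PF (u : ι → Fin n → ℝ) (Bs : Finset (Finset ι)) (h : ι → ℝ) : Prop where
  card : ∀ B ∈ Bs, B.card = n
  sep : ∀ B ∈ Bs, ∀ x : Fin n → ℝ, (∀ i ∈ B, u i ⬝ᵥ x = 0) → x = 0
  complete : ∀ w, ∃ B ∈ Bs, ∃ γ : ι → ℝ, (∀ i ∈ B, 0 ≤ γ i) ∧ w = ∑ i ∈ B, γ i • u i
  pt : ∀ B ∈ Bs, ∃ x, (∀ i ∈ B, u i ⬝ᵥ x = h i) ∧ ∀ i, i ∉ B → u i ⬝ᵥ x < h i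

/-- noncrossing -/
def NC (m : Fin n → ℝ) (u : ι → Fin n → ℝ) (Bs : Finset (Finset ι)) : Prop :=
  ∀ B ∈ Bs, (∀ i ∈ B, 0 ≤ m ⬝ᵥ u i) ∨ (∀ i ∈ B, m ⬝ᵥ u i ≤ 0)

lemma PF.exX {u : ι → Fin n → ℝ} {Bs h} (H : PF u Bs h) {B} (hB : B ∈ Bs) :
    ∃ X : (ι → ℝ) →ₗ[ℝ] (Fin n → ℝ), ∀ h, ∀ i ∈ B, u i ⬝ᵥ X h = h i := by
  let φ : (Fin n → ℝ) →ₗ[ℝ] (B → ℝ) :=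
    { toFun := fun x i => u i.1 ⬝ᵥ x
      map_add' := fun x y => by ext i; simp [dotProduct_add]
      map_smul' := fun c x => by ext i; simp [dotProduct_smul] }
  have hinj : Function.Injective φ := by
    rw [← LinearMap.ker_eq_bot, LinearMap.ker_eq_bot']
    intro x hx
    exact H.sep B hB x fun i hi => congrFun hx ⟨i, hi⟩
  have hfr : Module.finrank ℝ (Fin n → ℝ) = Module.finrank ℝ (B → ℝ) := by
    simp [H.card B hB]
  let e := LinearEquiv.ofInjectiveOfFinrankEq φ hinj hfr
  refine ⟨e.symm.toLinearMap ∘ₗ LinearMap.funLeft ℝ ℝ (fun i : B => i.1), fun h i hi => ?_⟩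
  have h1 : e (e.symm (LinearMap.funLeft ℝ ℝ (fun i : B => i.1) h)) = _ := e.apply_symm_apply _
  exact congrFun h1 ⟨i, hi⟩

lemma PF.toFan {u : ι → Fin n → ℝ} {Bs h} (H : PF u Bs h) :
    ∃ Φ : Fan n ι, Φ.u = u ∧ Φ.Bs = Bs ∧ Φ.C h := by
  have : ∀ B : Finset ι, ∃ X : (ι → ℝ) →ₗ[ℝ] (Fin n → ℝ), B ∈ Bs → ∀ h, ∀ i ∈ B, u i ⬝ᵥ X h = h i := by
    intro B
    by_cases hB : B ∈ Bs
    · obtain ⟨X, hX⟩ := H.exX hB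
      exact ⟨X, fun _ => hX⟩
    · exact ⟨0, fun h => absurd h hB⟩
  choose X hX using this
  have uniq : ∀ B ∈ Bs, ∀ h x, (∀ i ∈ B, u i ⬝ᵥ x = h i) → X B h = x := by
    intro B hB h x hx
    rw [← sub_eq_zero]
    exact H.sep B hB _ fun i hi => by rw [dotProduct_sub, hX B hB h i hi, hx i hi, sub_self]
  refine ⟨⟨u, Bs, H.card, X, hX, fun B hB w => ?_, H.complete⟩, rfl, rfl, fun B hB j hj => ?_⟩
  · refine ⟨fun i => w ⬝ᵥ X B (Pi.single i 1), ?_⟩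
    apply dotProduct_eq
    intro x
    rw [sum_dotProduct]
    have h1 : X B (fun i => u i ⬝ᵥ x) = x := uniq B hB _ x fun i _ => rfl
    have h2 : ∀ i, i ∉ B → X B (Pi.single i 1) = 0 := fun i hi => uniq B hB _ 0 fun l hl => by
      have : l ≠ i := fun h => hi (h ▸ hl)
      simp [this]
    conv_lhs => rw [← h1, single_sum (fun i => u i ⬝ᵥ x), map_sum, dotProduct_sum]
    symm
    apply Finset.sum_subset_zero_on_sdiff (Finset.subset_univ B)
    · intro i hi
      rw [map_smul, h2 i (by simpa using hi)]; simp
    · intro i _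
      simp [mul_comm]
  · obtain ⟨x, hx1, hx2⟩ := H.pt B hB
    show u j ⬝ᵥ X B h < h j
    rw [uniq B hB h x hx1]
    exact hx2 j hj

/-- rays after subdivision -/
def su (u : ι → Fin n → ℝ) (w : Fin n → ℝ) : Option ι → Fin n → ℝ := fun o => o.elim w u

/-- cones after subdivision -/
def sB (i j : ι) (Bs : Finset (Finset ι)) : Finset (Finset (Option ι)) :=
  (Bs.filter fun B => ¬ (i ∈ B ∧ j ∈ B)).image (fun B => B.map Function.Embedding.some) ∪
  ((Bs.filter fun B => i ∈ B ∧ j ∈ B).image (fun B => Finset.insertNone (B.erase i)) ∪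
  (Bs.filter fun B => i ∈ B ∧ j ∈ B).image (fun B => Finset.insertNone (B.erase j)))

lemma mem_sB {i j : ι} {Bs : Finset (Finset ι)} {B'} : B' ∈ sB i j Bs ↔
    (∃ B ∈ Bs, ¬ (i ∈ B ∧ j ∈ B) ∧ B' = B.map Function.Embedding.some) ∨
    (∃ B ∈ Bs, i ∈ B ∧ j ∈ B ∧ B' = Finset.insertNone (B.erase i)) ∨
    (∃ B ∈ Bs, i ∈ B ∧ j ∈ B ∧ B' = Finset.insertNone (B.erase j)) := by
  simp only [sB, Finset.mem_union, Finset.mem_image, Finset.mem_filter, and_assoc, eq_comm (a := B')]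

lemma PF.ev1 {u : ι → Fin n → ℝ} {Bs h} (H : PF u Bs h) {i j : ι} {a b : ℝ} (ha : 0 < a) (hb : 0 < b)
    {B} (hB : B ∈ Bs) (hij : ¬ (i ∈ B ∧ j ∈ B)) :
    ∀ᶠ ε in 𝓝[>] (0:ℝ), ∃ x, (∀ l ∈ B, u l ⬝ᵥ x = h l) ∧ (∀ l, l ∉ B → u l ⬝ᵥ x < h l) ∧
      a * (u i ⬝ᵥ x) + b * (u j ⬝ᵥ x) < a * h i + b * h j - ε := by
  obtain ⟨x, hx1, hx2⟩ := H.pt B hB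
  have hle : ∀ l, u l ⬝ᵥ x ≤ h l := fun l => by
    by_cases hl : l ∈ B
    · exact (hx1 l hl).le
    · exact (hx2 l hl).le
  have hpos : 0 < a * h i + b * h j - (a * (u i ⬝ᵥ x) + b * (u j ⬝ᵥ x)) := by
    have hi := mul_le_mul_of_nonneg_left (hle i) ha.le
    have hj := mul_le_mul_of_nonneg_left (hle j) hb.le
    by_cases h1 : i ∈ B
    · have h2 : j ∉ B := fun h => hij ⟨h1, h⟩
      have := mul_lt_mul_of_pos_left (hx2 j h2) hb
      linarith
    · have := mul_lt_mul_of_pos_left (hx2 i h1) ha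
      linarith
  filter_upwards [Ioo_mem_nhdsGT hpos] with ε hε
  exact ⟨x, hx1, hx2, by linarith [hε.2]⟩

lemma PF.ev2 {u : ι → Fin n → ℝ} {Bs h} (H : PF u Bs h) {i : ι} {a : ℝ} (ha : 0 < a)
    {B} (hB : B ∈ Bs) (hi : i ∈ B) :
    ∀ᶠ ε in 𝓝[>] (0:ℝ), ∃ x, (∀ l ∈ B.erase i, u l ⬝ᵥ x = h l) ∧ a * (u i ⬝ᵥ x) = a * h i - ε ∧
      (∀ l, l ∉ B.erase i → u l ⬝ᵥ x < h l) := by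
  obtain ⟨x, hx1, hx2⟩ := H.pt B hB
  obtain ⟨X, hX⟩ := H.exX hB
  set y := X (Pi.single i 1) with hy
  have hyi : u i ⬝ᵥ y = 1 := by rw [hX _ i hi]; simp
  have hyl : ∀ l ∈ B.erase i, u l ⬝ᵥ y = 0 := fun l hl => by
    rw [hX _ l (Finset.mem_of_mem_erase hl)]; simp [Finset.ne_of_mem_erase hl]
  have h1 : ∀ l, ∀ᶠ ε in 𝓝[>] (0:ℝ), l ∉ B → u l ⬝ᵥ x - ε / a * (u l ⬝ᵥ y) < h l := by
    intro l
    by_cases hl : l ∈ B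
    · exact Eventually.of_forall fun _ h => absurd hl h
    have hc : Continuous fun ε : ℝ => u l ⬝ᵥ x - ε / a * (u l ⬝ᵥ y) := by fun_prop
    have := (hc.tendsto 0).eventually_lt_const (u := h l) (by simpa using hx2 l hl)
    exact (this.filter_mono nhdsWithin_le_nhds).mono fun _ h _ => h
  rw [← eventually_all] at h1
  filter_upwards [h1, self_mem_nhdsWithin] with ε hε hpos
  have hpos' : 0 < ε := hpos
  have e : ∀ l, u l ⬝ᵥ (x - (ε / a) • y) = u l ⬝ᵥ x - ε / a * (u l ⬝ᵥ y) := fun l => by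
    rw [dotProduct_sub, dotProduct_smul, smul_eq_mul]
  refine ⟨x - (ε / a) • y, fun l hl => ?_, ?_, fun l hl => ?_⟩
  · rw [e, hyl l hl, hx1 l (Finset.mem_of_mem_erase hl)]; simp
  · rw [e, hyi, hx1 i hi]; field_simp
  · rw [e]
    by_cases hli : l = i
    · have : 0 < ε / a := by positivity
      rw [hli, hyi, hx1 i hi]; linarith
    · exact hε l fun h => hl (Finset.mem_erase.2 ⟨hli, h⟩)

lemma PF.half {u : ι → Fin n → ℝ} {B : Finset ι} {i j : ι} (hij : i ≠ j) (hi : i ∈ B) (hj : j ∈ B) {a b : ℝ}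
    (ha : 0 < a) (hb : 0 < b) (γ : ι → ℝ) (hγ : ∀ l ∈ B, 0 ≤ γ l) (hle : b * γ i ≤ a * γ j)
    (w : Fin n → ℝ) (hw : w = a • u i + b • u j) :
    ∃ γ' : Option ι → ℝ, (∀ l ∈ Finset.insertNone (B.erase i), 0 ≤ γ' l) ∧
      ∑ l ∈ B, γ l • u l = ∑ l ∈ Finset.insertNone (B.erase i), γ' l • su u w l := by
  refine ⟨fun o => o.elim (γ i / a) (Function.update γ j (γ j - γ i / a * b)), ?_, ?_⟩
  · intro o ho
    rcases o with _ | l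
    · have := hγ i hi
      simp only [Option.elim]; positivity
    · have hl : l ∈ B.erase i := by simpa using ho
      simp only [Option.elim]
      by_cases hlj : l = j
      · rw [hlj, Function.update_self, sub_nonneg, div_mul_eq_mul_div, div_le_iff₀ ha]; linarith
      · rw [Function.update_of_ne hlj]; exact hγ l (Finset.mem_of_mem_erase hl)
  · have hj' : j ∈ B.erase i := Finset.mem_erase.2 ⟨hij.symm, hj⟩
    rw [Finset.sum_insertNone, ← Finset.add_sum_erase B _ hi, ← Finset.add_sum_erase (B.erase i) _ hj',
      ← Finset.add_sum_erase (B.erase i) _ hj']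
    have : ∀ l ∈ (B.erase i).erase j, γ l • u l =
        (Option.elim (some l) (γ i / a) (Function.update γ j (γ j - γ i / a * b))) • su u w (some l) := by
      intro l hl
      simp only [Option.elim, su]
      rw [Function.update_of_ne (Finset.ne_of_mem_erase hl)]
    rw [Finset.sum_congr rfl this, ← add_assoc, ← add_assoc]
    congr 1
    simp only [Option.elim, su, Function.update_self, hw]
    ext k
    simp only [Pi.add_apply, Pi.smul_apply, smul_eq_mul]
    field_simp
    ring

lemma PF.subdiv {u : ι → Fin n → ℝ} {Bs h} (H : PF u Bs h) {i j : ι} (hij : i ≠ j) {a b : ℝ}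
    (ha : 0 < a) (hb : 0 < b) : ∃ h', PF (su u (a • u i + b • u j)) (sB i j Bs) h' := by
  have E1 : ∀ᶠ ε in 𝓝[>] (0:ℝ), ∀ B ∈ Bs, ¬ (i ∈ B ∧ j ∈ B) → ∃ x, (∀ l ∈ B, u l ⬝ᵥ x = h l) ∧
      (∀ l, l ∉ B → u l ⬝ᵥ x < h l) ∧ a * (u i ⬝ᵥ x) + b * (u j ⬝ᵥ x) < a * h i + b * h j - ε := by
    rw [Finset.eventually_all]
    intro B hB
    by_cases hc : i ∈ B ∧ j ∈ B
    · exact Eventually.of_forall fun _ h => absurd hc h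
    · exact (H.ev1 ha hb hB hc).mono fun _ h _ => h
  have E2 : ∀ (i : ι) (a : ℝ), 0 < a → ∀ᶠ ε in 𝓝[>] (0:ℝ), ∀ B ∈ Bs, i ∈ B → ∃ x,
      (∀ l ∈ B.erase i, u l ⬝ᵥ x = h l) ∧ a * (u i ⬝ᵥ x) = a * h i - ε ∧
      (∀ l, l ∉ B.erase i → u l ⬝ᵥ x < h l) := by
    intro i a ha
    rw [Finset.eventually_all]
    intro B hB
    by_cases hc : i ∈ B
    · exact (H.ev2 ha hB hc).mono fun _ h _ => h
    · exact Eventually.of_forall fun _ h => absurd h hc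
  obtain ⟨ε, h1, h2, h3⟩ := (E1.and ((E2 i a ha).and (E2 j b hb))).exists
  have hdot : ∀ x, su u (a • u i + b • u j) none ⬝ᵥ x = a * (u i ⬝ᵥ x) + b * (u j ⬝ᵥ x) := fun x => by
    simp [su, add_dotProduct, smul_dotProduct]
  have hdots : ∀ l x, su u (a • u i + b • u j) (some l) ⬝ᵥ x = u l ⬝ᵥ x := fun l x => rfl
  refine ⟨fun o => o.elim (a * h i + b * h j - ε) h, ?_, ?_, ?_, ?_⟩
  · intro B' hB'
    rcases mem_sB.1 hB' with ⟨B, hB, -, rfl⟩ | ⟨B, hB, hi, hj, rfl⟩ | ⟨B, hB, hi, hj, rfl⟩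
    · rw [Finset.card_map, H.card B hB]
    · rw [Finset.card_insertNone, Finset.card_erase_add_one hi, H.card B hB]
    · rw [Finset.card_insertNone, Finset.card_erase_add_one hj, H.card B hB]
  · intro B' hB' x hx
    rcases mem_sB.1 hB' with ⟨B, hB, -, rfl⟩ | ⟨B, hB, hi, hj, rfl⟩ | ⟨B, hB, hi, hj, rfl⟩
    · exact H.sep B hB x fun l hl => hx (some l) (by simpa using hl)
    · have e0 := hx none (by simp)
      have e1 : ∀ l ∈ B.erase i, u l ⬝ᵥ x = 0 := fun l hl => hx (some l) (by simpa using hl)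
      rw [hdot, e1 j (Finset.mem_erase.2 ⟨hij.symm, hj⟩), mul_zero, add_zero] at e0
      refine H.sep B hB x fun l hl => ?_
      by_cases hli : l = i
      · rw [hli]; exact (mul_eq_zero.1 e0).resolve_left ha.ne'
      · exact e1 l (Finset.mem_erase.2 ⟨hli, hl⟩)
    · have e0 := hx none (by simp)
      have e1 : ∀ l ∈ B.erase j, u l ⬝ᵥ x = 0 := fun l hl => hx (some l) (by simpa using hl)
      rw [hdot, e1 i (Finset.mem_erase.2 ⟨hij, hi⟩), mul_zero, zero_add] at e0
      refine H.sep B hB x fun l hl => ?_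
      by_cases hli : l = j
      · rw [hli]; exact (mul_eq_zero.1 e0).resolve_left hb.ne'
      · exact e1 l (Finset.mem_erase.2 ⟨hli, hl⟩)
  · intro w
    obtain ⟨B, hB, γ, hγ, rfl⟩ := H.complete w
    by_cases hc : i ∈ B ∧ j ∈ B
    · rcases le_total (b * γ i) (a * γ j) with hle | hle
      · obtain ⟨γ', g1, g2⟩ := PF.half (u := u) hij hc.1 hc.2 ha hb γ hγ hle _ rfl
        exact ⟨_, mem_sB.2 (Or.inr (Or.inl ⟨B, hB, hc.1, hc.2, rfl⟩)), γ', g1, g2⟩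
      · obtain ⟨γ', g1, g2⟩ := PF.half (u := u) hij.symm hc.2 hc.1 hb ha γ hγ hle _ (add_comm _ _)
        exact ⟨_, mem_sB.2 (Or.inr (Or.inr ⟨B, hB, hc.1, hc.2, rfl⟩)), γ', g1, g2⟩
    · refine ⟨_, mem_sB.2 (Or.inl ⟨B, hB, hc, rfl⟩), fun o => o.elim 0 γ, ?_, ?_⟩
      · intro o ho
        obtain ⟨l, hl, rfl⟩ := Finset.mem_map.1 ho
        exact hγ l hl
      · rw [Finset.sum_map]; rfl
  · intro B' hB'
    rcases mem_sB.1 hB' with ⟨B, hB, hc, rfl⟩ | ⟨B, hB, hi, hj, rfl⟩ | ⟨B, hB, hi, hj, rfl⟩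
    · obtain ⟨x, g1, g2, g3⟩ := h1 B hB hc
      refine ⟨x, ?_, ?_⟩
      · intro o ho
        obtain ⟨l, hl, rfl⟩ := Finset.mem_map.1 ho
        exact g1 l hl
      · rintro (_ | l) ho
        · rw [hdot]; exact g3
        · exact g2 l fun hl => ho (by simpa using hl)
    · obtain ⟨x, g1, g2, g3⟩ := h2 B hB hi
      refine ⟨x, ?_, ?_⟩
      · rintro (_ | l) ho
        · rw [hdot, g2, g1 j (Finset.mem_erase.2 ⟨hij.symm, hj⟩)]; simp only [Option.elim]; ring
        · exact g1 l (by simpa using ho)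
      · rintro (_ | l) ho
        · exact absurd (by simp) ho
        · exact g3 l fun hl => ho (by simpa using hl)
    · obtain ⟨x, g1, g2, g3⟩ := h3 B hB hj
      refine ⟨x, ?_, ?_⟩
      · rintro (_ | l) ho
        · rw [hdot, g2, g1 i (Finset.mem_erase.2 ⟨hij, hi⟩)]; simp only [Option.elim]; ring
        · exact g1 l (by simpa using ho)
      · rintro (_ | l) ho
        · exact absurd (by simp) ho
        · exact g3 l fun hl => ho (by simpa using hl)

end
end AFI

namespace AFI
open Filter Topology

section
variable {n : ℕ}

open Classical in
/-- crossing pairs -/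
noncomputable def cr {ι : Type} [Fintype ι] (m : Fin n → ℝ) (u : ι → Fin n → ℝ) (Bs : Finset (Finset ι)) :
    Finset (ι × ι) :=
  Finset.univ.filter fun q => 0 < m ⬝ᵥ u q.1 ∧ m ⬝ᵥ u q.2 < 0 ∧ ∃ B ∈ Bs, q.1 ∈ B ∧ q.2 ∈ B

lemma sB_parent {ι : Type} [Fintype ι] [DecidableEq ι] {i j : ι} {Bs : Finset (Finset ι)} {B'} (h : B' ∈ sB i j Bs) :
    ∃ B ∈ Bs, (∀ l, some l ∈ B' → l ∈ B) ∧ (none ∈ B' → i ∈ B ∧ j ∈ B) ∧ ¬ (some i ∈ B' ∧ some j ∈ B') := by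
  rcases mem_sB.1 h with ⟨B, hB, hc, rfl⟩ | ⟨B, hB, hi, hj, rfl⟩ | ⟨B, hB, hi, hj, rfl⟩
  · exact ⟨B, hB, by simp, by simp, by simpa using hc⟩
  · exact ⟨B, hB, by simp, fun _ => ⟨hi, hj⟩, by simp⟩
  · exact ⟨B, hB, by simp, fun _ => ⟨hi, hj⟩, by simp⟩

lemma NC_step (m : Fin n → ℝ) (N : ℕ) : ∀ (ι : Type) (_ : Fintype ι) (_ : DecidableEq ι) (u : ι → Fin n → ℝ)
    (Bs : Finset (Finset ι)) (h : ι → ℝ), PF u Bs h → (cr m u Bs).card ≤ N →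
    ∃ (ι' : Type) (_ : Fintype ι') (_ : DecidableEq ι') (u' : ι' → Fin n → ℝ)
      (Bs' : Finset (Finset ι')) (h' : ι' → ℝ), PF u' Bs' h' ∧ NC m u' Bs' ∧
      ∀ m', NC m' u Bs → NC m' u' Bs' := by
  induction N with
  | zero =>
    intro ι _ _ u Bs h H hcr
    refine ⟨ι, inferInstance, inferInstance, u, Bs, h, H, ?_, fun _ h => h⟩
    intro B hB
    by_contra hcon
    push Not at hcon
    obtain ⟨⟨i, hi, hi'⟩, j, hj, hj'⟩ := hcon
    have : (j, i) ∈ cr m u Bs := by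
      simp only [cr, Finset.mem_filter, Finset.mem_univ, true_and]
      exact ⟨hj', hi', B, hB, hj, hi⟩
    rw [Finset.card_eq_zero.1 (Nat.le_zero.1 hcr)] at this
    simp at this
  | succ N ih =>
    intro ι _ _ u Bs h H hcr
    by_cases hne : (cr m u Bs).Nonempty
    swap
    · rw [Finset.not_nonempty_iff_eq_empty] at hne
      exact ih ι inferInstance inferInstance u Bs h H (by rw [hne]; simp)
    obtain ⟨⟨i, j⟩, hq⟩ := hne
    have hq' := hq
    simp only [cr, Finset.mem_filter, Finset.mem_univ, true_and] at hq'
    obtain ⟨hi, hj, -⟩ := hq'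
    have hij : i ≠ j := by
      rintro rfl
      exact lt_asymm hi hj
    obtain ⟨h', H'⟩ := H.subdiv hij (a := - (m ⬝ᵥ u j)) (b := m ⬝ᵥ u i) (by linarith) hi
    set w := -(m ⬝ᵥ u j) • u i + (m ⬝ᵥ u i) • u j with hw
    have hmw : m ⬝ᵥ w = 0 := by
      rw [hw, dotProduct_add, dotProduct_smul, dotProduct_smul, smul_eq_mul, smul_eq_mul]; ring
    have hlt : (cr m (su u w) (sB i j Bs)).card ≤ N := by
      have hsub : cr m (su u w) (sB i j Bs) ⊆
          ((cr m u Bs).erase (i, j)).map (Function.Embedding.prodMap Function.Embedding.some Function.Embedding.some) := by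
        rintro ⟨o1, o2⟩ ho
        simp only [cr, Finset.mem_filter, Finset.mem_univ, true_and] at ho
        obtain ⟨h1, h2, B', hB', h3, h4⟩ := ho
        rcases o1 with _ | l1
        · exact absurd h1 (by show ¬ (0 < m ⬝ᵥ w); rw [hmw]; exact lt_irrefl _)
        rcases o2 with _ | l2
        · exact absurd h2 (by show ¬ (m ⬝ᵥ w < 0); rw [hmw]; exact lt_irrefl _)
        obtain ⟨B, hB, p1, -, p3⟩ := sB_parent hB'
        refine Finset.mem_map.2 ⟨(l1, l2), Finset.mem_erase.2 ⟨?_, ?_⟩, rfl⟩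
        · intro heq
          rw [Prod.mk.injEq] at heq
          rw [heq.1] at h3
          rw [heq.2] at h4
          exact p3 ⟨h3, h4⟩
        · simp only [cr, Finset.mem_filter, Finset.mem_univ, true_and]
          exact ⟨h1, h2, B, hB, p1 _ h3, p1 _ h4⟩
      have h1 := Finset.card_le_card hsub
      rw [Finset.card_map, Finset.card_erase_of_mem hq] at h1
      omega
    obtain ⟨ι', i1, i2, u', Bs', h'', H'', g1, g2⟩ := ih (Option ι) inferInstance inferInstance _ _ h' H' hlt
    refine ⟨ι', i1, i2, u', Bs', h'', H'', g1, fun m' hm' => g2 m' ?_⟩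
    intro B' hB'
    obtain ⟨B, hB, p1, p2, -⟩ := sB_parent hB'
    have hdot : m' ⬝ᵥ w = -(m ⬝ᵥ u j) * (m' ⬝ᵥ u i) + (m ⬝ᵥ u i) * (m' ⬝ᵥ u j) := by
      rw [hw, dotProduct_add, dotProduct_smul, dotProduct_smul, smul_eq_mul, smul_eq_mul]
    have ha : 0 ≤ -(m ⬝ᵥ u j) := by linarith
    rcases hm' B hB with hp | hp
    · left
      rintro (_ | l) hl
      · show 0 ≤ m' ⬝ᵥ w
        rw [hdot]
        have := p2 hl
        exact add_nonneg (mul_nonneg ha (hp i this.1)) (mul_nonneg hi.le (hp j this.2))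
      · exact hp l (p1 l hl)
    · right
      rintro (_ | l) hl
      · show m' ⬝ᵥ w ≤ 0
        rw [hdot]
        have := p2 hl
        exact add_nonpos (mul_nonpos_of_nonneg_of_nonpos ha (hp i this.1))
          (mul_nonpos_of_nonneg_of_nonpos hi.le (hp j this.2))
      · exact hp l (p1 l hl)

/-- sign -/
def sg (b : Bool) : ℝ := if b then 1 else -1

lemma PF_base (n : ℕ) : ∃ (u : Fin n × Bool → Fin n → ℝ) (Bs : Finset (Finset (Fin n × Bool))) (h : Fin n × Bool → ℝ),
    PF u Bs h := by
  have hmem : ∀ s : Fin n → Bool, ∀ q : Fin n × Bool, q ∈ (Finset.univ.image fun i => (i, s i)) ↔ q.2 = s q.1 := by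
    rintro s ⟨i, b⟩
    simp [eq_comm]
  have hinj : ∀ s : Fin n → Bool, Function.Injective (fun i => (i, s i)) := fun s i j h => (Prod.mk.inj h).1
  have hdot : ∀ (i : Fin n) (b : Bool) x, (Pi.single i (sg b) : Fin n → ℝ) ⬝ᵥ x = sg b * x i := fun i b x => by
    simp
  have hsq : ∀ b, sg b * sg b = 1 := by intro b; cases b <;> simp [sg]
  refine ⟨fun q => Pi.single q.1 (sg q.2), Finset.univ.image (fun s : Fin n → Bool => Finset.univ.image fun i => (i, s i)),
    fun _ => 1, ?_, ?_, ?_, ?_⟩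
  · intro B hB
    obtain ⟨s, -, rfl⟩ := Finset.mem_image.1 hB
    rw [Finset.card_image_of_injective _ (hinj s)]; simp
  · intro B hB x hx
    obtain ⟨s, -, rfl⟩ := Finset.mem_image.1 hB
    ext i
    have := hx (i, s i) ((hmem s _).2 rfl)
    rw [hdot] at this
    have h2 := hsq (s i)
    rcases mul_eq_zero.1 this with h | h
    · rw [h] at h2; simp at h2
    · exact h
  · intro w
    refine ⟨_, Finset.mem_image.2 ⟨fun i => decide (0 ≤ w i), Finset.mem_univ _, rfl⟩, fun q => |w q.1|,
      fun _ _ => abs_nonneg _, ?_⟩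
    rw [Finset.sum_image (hinj (fun i => decide (0 ≤ w i))).injOn]
    ext k
    rw [Finset.sum_apply, Finset.sum_eq_single k]
    · by_cases hk : 0 ≤ w k
      · simp [sg, hk, abs_of_nonneg hk]
      · have := (not_le.1 hk).le
        simp [sg, hk, abs_of_nonpos this]
    · intro i _ hik
      simp [hik.symm]
    · simp
  · intro B hB
    obtain ⟨s, -, rfl⟩ := Finset.mem_image.1 hB
    refine ⟨fun i => sg (s i), ?_, ?_⟩
    · rintro ⟨i, b⟩ hq
      rw [hmem] at hq
      simp only at hq
      rw [hdot, hq, hsq]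
    · rintro ⟨i, b⟩ hq
      rw [hmem] at hq
      simp only at hq
      rw [hdot]
      cases b <;> cases hs : s i <;> simp_all [sg]

lemma exists_fan (M : Finset (Fin n → ℝ)) : ∃ (ι : Type) (_ : Fintype ι) (_ : DecidableEq ι) (Φ : Fan n ι) (h0 : ι → ℝ),
    Φ.C h0 ∧ ∀ m ∈ M, NC m Φ.u Φ.Bs := by
  have key : ∃ (ι : Type) (_ : Fintype ι) (_ : DecidableEq ι) (u : ι → Fin n → ℝ) (Bs : Finset (Finset ι)) (h : ι → ℝ),
      PF u Bs h ∧ ∀ m ∈ M, NC m u Bs := by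
    classical
    induction M using Finset.induction_on with
    | empty =>
      obtain ⟨u, Bs, h, H⟩ := PF_base n
      exact ⟨_, inferInstance, inferInstance, u, Bs, h, H, by simp⟩
    | insert m M hm ih =>
      obtain ⟨ι, i1, i2, u, Bs, h, H, hM⟩ := ih
      obtain ⟨ι', j1, j2, u', Bs', h', H', g1, g2⟩ := NC_step m _ ι i1 i2 u Bs h H le_rfl
      refine ⟨ι', j1, j2, u', Bs', h', H', fun m' hm' => ?_⟩
      rcases Finset.mem_insert.1 hm' with rfl | hm'
      · exact g1
      · exact g2 m' (hM m' hm')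
  obtain ⟨ι, i1, i2, u, Bs, h, H, hM⟩ := key
  obtain ⟨Φ, rfl, rfl, hC⟩ := H.toFan
  exact ⟨ι, i1, i2, Φ, h, hC, hM⟩

end
end AFI

namespace AFI
open Filter Topology

lemma net {n : ℕ} {K : Set (Fin n → ℝ)} (hK : IsCompact K) {δ : ℝ} (hδ : 0 < δ) :
    ∃ V : Finset (Fin n → ℝ), (∀ v ∈ V, ∃ y ∈ K, dist v y ≤ δ) ∧
      ∀ w : Fin n → ℝ, ∀ k ∈ K, ∃ v ∈ V, w ⬝ᵥ k ≤ w ⬝ᵥ v := by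
  classical
  obtain ⟨t, htK, htf, hcov⟩ := hK.finite_cover_balls hδ
  refine ⟨(htf.toFinset ×ˢ (Finset.univ : Finset (Fin n → Bool))).image
    (fun q => q.1 + δ • fun i => sg (q.2 i)), ?_, ?_⟩
  · intro v hv
    obtain ⟨⟨x, s⟩, hq, rfl⟩ := Finset.mem_image.1 hv
    have hx : x ∈ t := by
      have := (Finset.mem_product.1 hq).1
      simpa using this
    refine ⟨x, htK hx, ?_⟩
    rw [dist_eq_norm, add_sub_cancel_left, pi_norm_le_iff_of_nonneg hδ.le]
    intro i
    simp only [Pi.smul_apply, smul_eq_mul, norm_mul, Real.norm_eq_abs, abs_of_pos hδ]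
    have : |sg (s i)| = 1 := by cases s i <;> simp [sg]
    rw [this, mul_one]
  · intro w k hk
    obtain ⟨x, hx, hkx⟩ := Set.mem_iUnion₂.1 (hcov hk)
    refine ⟨_, Finset.mem_image.2 ⟨(x, fun i => decide (0 ≤ w i)), Finset.mem_product.2 ⟨by simpa using hx, Finset.mem_univ _⟩, rfl⟩, ?_⟩
    refine Finset.sum_le_sum fun i _ => ?_
    have h1 : |k i - x i| ≤ δ := by
      have := (dist_pi_le_iff hδ.le).1 (Metric.mem_ball.1 hkx).le i
      rwa [Real.dist_eq] at this
    have h2 := abs_le.1 h1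
    simp only [Pi.add_apply, Pi.smul_apply, smul_eq_mul]
    by_cases hw : 0 ≤ w i
    · simp only [sg, hw, decide_true, if_true]
      exact mul_le_mul_of_nonneg_left (by linarith) hw
    · simp only [sg, hw, decide_false]
      exact mul_le_mul_of_nonpos_left (by simp; linarith) (not_le.1 hw).le

lemma Fan.C.trans {n : ℕ} {ι : Type} [Fintype ι] [DecidableEq ι] {Φ : Fan n ι} {h : ι → ℝ} (hh : Φ.C h)
    (y : Fin n → ℝ) : Φ.C (h - Φ.τ y) := by
  intro B hB j hj
  have : Φ.X B (Φ.τ y) = y := by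
    rw [← sub_eq_zero]
    exact Φ.sep hB _ fun i hi => by rw [dotProduct_sub, Φ.hX B hB _ i hi]; simp [Fan.τ]
  rw [map_sub, this, dotProduct_sub]
  have := hh B hB j hj
  simp only [Pi.sub_apply, Fan.τ]
  linarith

lemma approx {n : ℕ} (K : Fin n → Set (Fin n → ℝ)) (hne : ∀ j, (K j).Nonempty) (hc : ∀ j, IsCompact (K j))
    (hcv : ∀ j, Convex ℝ (K j)) {δ : ℝ} (hδ : 0 < δ) :
    ∃ (ι : Type) (_ : Fintype ι) (_ : DecidableEq ι) (Φ : Fan n ι) (h : Fin n → ι → ℝ), (∀ j, Φ.C (h j)) ∧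
      ∀ j, K j ⊆ Φ.P (h j) ∧ ∀ x ∈ Φ.P (h j), ∃ y ∈ K j, dist x y ≤ δ := by
  classical
  choose V hV1 hV2 using fun j => net (hc j) (half_pos hδ)
  have hVne : ∀ j, (V j).Nonempty := fun j => by
    obtain ⟨k, hk⟩ := hne j
    obtain ⟨v, hv, -⟩ := hV2 j 0 k hk
    exact ⟨v, hv⟩
  obtain ⟨ι, i1, i2, Φ, h1, hC1, hM⟩ := exists_fan
    (Finset.univ.biUnion fun j => ((V j) ×ˢ (V j)).image fun q => q.1 - q.2)
  have hM' : ∀ j, ∀ v ∈ V j, ∀ v' ∈ V j, NC (v - v') Φ.u Φ.Bs := fun j v hv v' hv' =>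
    hM _ (Finset.mem_biUnion.2 ⟨j, Finset.mem_univ _, Finset.mem_image.2 ⟨(v, v'), Finset.mem_product.2 ⟨hv, hv'⟩, rfl⟩⟩)
  obtain ⟨B0, hB0, -⟩ := Φ.complete 0
  set h0 := h1 - Φ.τ (Φ.X B0 h1) with hh0
  have hC0 : Φ.C h0 := hC1.trans _
  have h0nn : ∀ i, 0 ≤ h0 i := fun i => by
    have := hC1.le hB0 i
    simp only [hh0, Pi.sub_apply, Fan.τ]; linarith
  set g : Fin n → ι → ℝ := fun j i => (V j).sup' (hVne j) (fun v => Φ.u i ⬝ᵥ v) with hg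
  have hgle : ∀ j i, ∀ v ∈ V j, Φ.u i ⬝ᵥ v ≤ g j i := fun j i v hv =>
    Finset.le_sup' (fun v => Φ.u i ⬝ᵥ v) hv
  have hXg : ∀ j, ∀ B ∈ Φ.Bs, Φ.X B (g j) ∈ V j := by
    intro j B hB
    obtain ⟨v, hv, hmax⟩ := Finset.exists_max_image (V j) (fun v => ∑ i ∈ B, Φ.u i ⬝ᵥ v) (hVne j)
    have hge : ∀ v' ∈ V j, ∀ i ∈ B, Φ.u i ⬝ᵥ v' ≤ Φ.u i ⬝ᵥ v := by
      intro v' hv' i hi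
      have e : ∀ i, (v - v') ⬝ᵥ Φ.u i = Φ.u i ⬝ᵥ v - Φ.u i ⬝ᵥ v' := fun i => by
        rw [dotProduct_comm, dotProduct_sub]
      rcases hM' j v hv v' hv' B hB with hp | hp
      · have := hp i hi
        rw [e] at this; linarith
      · have hle : ∀ i ∈ B, Φ.u i ⬝ᵥ v ≤ Φ.u i ⬝ᵥ v' := fun i hi => by
          have := hp i hi
          rw [e] at this; linarith
        have heq := (Finset.sum_eq_sum_iff_of_le hle).1 (le_antisymm (Finset.sum_le_sum hle) (hmax v' hv'))
        exact (heq i hi).ge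
    have : Φ.X B (g j) = v := by
      rw [← sub_eq_zero]
      refine Φ.sep hB _ fun i hi => ?_
      rw [dotProduct_sub, Φ.hX B hB _ i hi, sub_eq_zero]
      exact le_antisymm (Finset.sup'_le _ _ fun v' hv' => hge v' hv' i hi) (hgle j i v hv)
    rw [this]; exact hv
  have hCw : ∀ j, Φ.Cw (g j) := fun j B hB i => hgle j i _ (hXg j B hB)
  set R := ∑ B ∈ Φ.Bs, ‖Φ.X B h0‖ with hR
  have hR0 : 0 ≤ R := Finset.sum_nonneg fun _ _ => norm_nonneg _
  set ε := δ / 2 / (R + 1) with hε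
  have hε0 : 0 < ε := by positivity
  have hCh : ∀ j, Φ.C (g j + ε • h0) := fun j => (hCw j).add_C (hC0.smul hε0)
  refine ⟨ι, i1, i2, Φ, fun j => g j + ε • h0, hCh, fun j => ⟨?_, ?_⟩⟩
  · intro k hk i
    obtain ⟨v, hv, hle⟩ := hV2 j (Φ.u i) k hk
    have h2 := hgle j i v hv
    have h3 := mul_nonneg hε0.le (h0nn i)
    simp only [Pi.add_apply, Pi.smul_apply, smul_eq_mul]
    linarith
  · intro x hx
    have hsub : Φ.P (g j + ε • h0) ⊆ Metric.cthickening δ (K j) := by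
      rw [Fan.P_hull (hCh j).w]
      refine convexHull_min ?_ ((hcv j).cthickening δ)
      rintro _ ⟨B, hB, rfl⟩
      obtain ⟨y, hy, hd⟩ := hV1 j _ (hXg j B hB)
      refine Metric.mem_cthickening_of_dist_le _ y _ _ hy ?_
      have hle : ‖Φ.X B h0‖ ≤ R := Finset.single_le_sum (f := fun B => ‖Φ.X B h0‖) (fun _ _ => norm_nonneg _) hB
      have h5 : ε * ‖Φ.X B h0‖ ≤ δ / 2 := by
        rw [hε, div_mul_eq_mul_div, div_le_iff₀ (by positivity)]
        exact mul_le_mul_of_nonneg_left (by linarith) (by positivity)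
      have h6 : dist (Φ.X B (g j + ε • h0)) (Φ.X B (g j)) ≤ δ / 2 := by
        rw [dist_eq_norm, map_add, add_sub_cancel_left, map_smul, norm_smul, Real.norm_eq_abs, abs_of_pos hε0]
        exact h5
      have := dist_triangle (Φ.X B (g j + ε • h0)) (Φ.X B (g j)) y
      show dist (Φ.X B (g j + ε • h0)) y ≤ δ
      linarith
    have hx' := hsub hx
    rw [(hc j).cthickening_eq_biUnion_closedBall hδ.le] at hx'
    obtain ⟨y, hy, hxy⟩ := Set.mem_iUnion₂.1 hx'
    exact ⟨y, hy, hxy⟩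

lemma compact_sum {n : ℕ} (S : Finset (Fin n)) (K : Fin n → Set (Fin n → ℝ)) (hc : ∀ j, IsCompact (K j)) :
    IsCompact (∑ j ∈ S, K j) := by
  induction S using Finset.induction_on with
  | empty => simpa using (isCompact_singleton (x := (0 : Fin n → ℝ)))
  | insert j S hj ih => rw [Finset.sum_insert hj]; exact (hc j).add ih

lemma MV_tendsto {n : ℕ} (K : Fin n → Set (Fin n → ℝ)) (hc : ∀ j, IsCompact (K j))
    (Q : ℕ → Fin n → Set (Fin n → ℝ)) (hKQ : ∀ k j, K j ⊆ Q k j)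
    (hQ : ∀ k j, ∀ x ∈ Q k j, ∃ y ∈ K j, dist x y ≤ 1 / ((k:ℝ) + 1)) :
    Tendsto (fun k => MV n (Q k)) atTop (𝓝 (MV n K)) := by
  have key : ∀ S : Finset (Fin n), Tendsto (fun k => vol (∑ j ∈ S, Q k j)) atTop (𝓝 (vol (∑ j ∈ S, K j))) := by
    intro S
    have hcS := compact_sum S K hc
    refine (ENNReal.tendsto_toReal hcS.measure_lt_top.ne).comp ?_
    have h1 : Tendsto (fun k : ℕ => volume (Metric.cthickening (S.card * (1 / ((k:ℝ) + 1))) (∑ j ∈ S, K j))) atTop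
        (𝓝 (volume (∑ j ∈ S, K j))) := by
      refine (tendsto_measure_cthickening_of_isCompact hcS).comp ?_
      simpa using (tendsto_one_div_add_atTop_nhds_zero_nat (𝕜 := ℝ)).const_mul (S.card : ℝ)
    refine tendsto_of_tendsto_of_tendsto_of_le_of_le tendsto_const_nhds h1 ?_ ?_
    · intro k
      exact measure_mono (Set.finsetSum_subset_finsetSum _ _ _ fun j _ => hKQ k j)
    · intro k
      refine measure_mono ?_
      intro x hx
      obtain ⟨f, hf, rfl⟩ := (Set.mem_finsetSum _ _ _).1 hx
      have : ∀ j, ∃ y, j ∈ S → y ∈ K j ∧ dist (f j) y ≤ 1 / ((k:ℝ) + 1) := by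
        intro j
        by_cases hj : j ∈ S
        · obtain ⟨y, hy⟩ := hQ k j _ (hf hj)
          exact ⟨y, fun _ => hy⟩
        · exact ⟨0, fun h => absurd h hj⟩
      choose y hy using this
      refine Metric.mem_cthickening_of_dist_le _ (∑ j ∈ S, y j) _ _
        ((Set.mem_finsetSum _ _ _).2 ⟨y, fun hj => (hy _ hj).1, rfl⟩) ?_
      refine (dist_sum_sum_le_of_le S fun j hj => (hy j hj).2).trans ?_
      simp
  unfold MV
  refine tendsto_finsetSum _ fun j _ => Tendsto.const_mul _ ?_
  exact tendsto_finsetSum _ fun S _ => key S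

lemma univ_split {n m : ℕ} (hmn : m ≤ n) {β : Type} (f : Fin n → β) :
    (Finset.univ : Finset (Fin n)).val.map f = (Finset.univ : Finset (Fin m)).val.map (fun i => f (Fin.castLE hmn i)) +
      ((Finset.univ : Finset (Fin n)).filter fun k : Fin n => ¬ (k : ℕ) < m).val.map f := by
  have h1 : (Finset.univ : Finset (Fin n)).filter (fun k : Fin n => (k : ℕ) < m) =
      (Finset.univ : Finset (Fin m)).map (Fin.castLEEmb hmn) := by
    ext k
    simp only [Finset.mem_filter, Finset.mem_univ, true_and, Finset.mem_map]
    constructor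
    · intro hk; exact ⟨⟨k, hk⟩, rfl⟩
    · rintro ⟨i, rfl⟩; exact i.2
  have h2 : (Finset.univ : Finset (Fin m)).val.map (fun i => f (Fin.castLE hmn i)) =
      ((Finset.univ : Finset (Fin n)).filter fun k : Fin n => (k : ℕ) < m).val.map f := by
    rw [h1, Finset.map_val, Multiset.map_map]; rfl
  rw [h2, ← Multiset.map_add, Finset.filter_val, Finset.filter_val, Multiset.filter_add_not]

/-- replace the first `m` indices by `i` -/
def rep {n m : ℕ} (hmn : m ≤ n) (i : Fin m) (k : Fin n) : Fin n := if (k : ℕ) < m then Fin.castLE hmn i else k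

lemma poly_ineq {n m : ℕ} (hm : 0 < m) (hmn : m ≤ n) {ι : Type} [Fintype ι] [DecidableEq ι] (Φ : Fan n ι)
    (h : Fin n → ι → ℝ) (hh : ∀ j, Φ.C (h j)) :
    ∏ i : Fin m, MV n (fun k => Φ.P (h (rep hmn i k))) ≤ MV n (fun k => Φ.P (h k)) ^ m := by
  have hn : 0 < n := by omega
  have hF := Fan.F_form (hh ⟨0, hn⟩)
  set r := ((Finset.univ : Finset (Fin n)).filter fun k : Fin n => ¬ (k : ℕ) < m).val.map h with hr
  have hcard : m + Multiset.card r = n := by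
    have := congrArg Multiset.card (univ_split hmn h)
    simp only [Multiset.card_map, Multiset.card_add, Finset.card_val, Finset.card_univ, Fintype.card_fin] at this
    simp only [hr, Multiset.card_map, Finset.card_val]
    omega
  have h1 := hF.ineq hm (fun i => h (Fin.castLE hmn i)) (fun i => hh _) r (fun x hx => by
    obtain ⟨k, -, rfl⟩ := Multiset.mem_map.1 hx
    exact hh k) hcard
  rw [← Fan.F_MV hn h hh, univ_split hmn h]
  refine le_trans (le_of_eq ?_) h1
  refine Finset.prod_congr rfl fun i _ => ?_
  rw [← Fan.F_MV hn (fun k => h (rep hmn i k)) (fun k => hh _), univ_split hmn]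
  congr 2
  · have : ∀ j : Fin m, h (rep hmn i (Fin.castLE hmn j)) = h (Fin.castLE hmn i) := fun j => by
      rw [rep, if_pos (by exact j.2)]
    simp only [this, Multiset.map_const', Finset.card_val, Finset.card_univ, Fintype.card_fin]
  · refine Multiset.map_congr rfl fun k hk => ?_
    have : ¬ (k : ℕ) < m := by
      have := Finset.mem_def.2 hk
      simpa using this
    rw [rep, if_neg this]

lemma body_ineq {n m : ℕ} (hm : 0 < m) (hmn : m ≤ n) (K : Fin n → Set (Fin n → ℝ)) (hne : ∀ j, (K j).Nonempty)
    (hc : ∀ j, IsCompact (K j)) (hcv : ∀ j, Convex ℝ (K j)) :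
    ∏ i : Fin m, MV n (fun k => K (rep hmn i k)) ≤ MV n K ^ m := by
  have : ∀ k : ℕ, ∃ Q : Fin n → Set (Fin n → ℝ), (∀ j, K j ⊆ Q j) ∧
      (∀ j, ∀ x ∈ Q j, ∃ y ∈ K j, dist x y ≤ 1 / ((k:ℝ) + 1)) ∧
      ∏ i : Fin m, MV n (fun k => Q (rep hmn i k)) ≤ MV n Q ^ m := by
    intro k
    obtain ⟨ι, i1, i2, Φ, h, hh, hK⟩ := approx K hne hc hcv (δ := 1 / ((k:ℝ) + 1)) (by positivity)
    exact ⟨fun j => Φ.P (h j), fun j => (hK j).1, fun j => (hK j).2, poly_ineq hm hmn Φ h hh⟩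
  choose Q hQ1 hQ2 hQ3 using this
  refine le_of_tendsto_of_tendsto' (tendsto_finsetProd _ fun i _ => ?_) ((MV_tendsto K hc Q hQ1 hQ2).pow m) hQ3
  exact MV_tendsto (fun k => K (rep hmn i k)) (fun _ => hc _) (fun l k => Q l (rep hmn i k)) (fun l k => hQ1 l _)
    (fun l k => hQ2 l _)

end AFI

/-- Intermediate inequality (7.2) in the proof of Theorem 7.3:
`MV(A₁, …, A_{p−1}, H, L₁, …, L_{n−p})^{p−1} ≥ Π_{i=1}^{p−1} MV(A_i^{(p−1)}, H, L₁, …, L_{n−p})`. -/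
theorem intermediate_inequality {n p : ℕ} (hp1 : 1 ≤ p) (hpn : p ≤ n)
    (A : Fin (p - 1) → Set (Fin n → ℝ)) (H : Set (Fin n → ℝ))
    (L : Fin (n - p) → Set (Fin n → ℝ))
    (hAne : ∀ i, (A i).Nonempty) (hAc : ∀ i, IsCompact (A i)) (hAcv : ∀ i, Convex ℝ (A i))
    (hHne : H.Nonempty) (hHc : IsCompact H) (hHcv : Convex ℝ H)
    (hLne : ∀ i, (L i).Nonempty) (hLc : ∀ i, IsCompact (L i)) (hLcv : ∀ i, Convex ℝ (L i)) :
    MV n (fam hp1 hpn A H L) ^ (p - 1) ≥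
      ∏ i : Fin (p - 1), MV n (fam hp1 hpn (fun _ => A i) H L) := by
  have key : ∀ (P : Set (Fin n → ℝ) → Prop), (∀ i, P (A i)) → P H → (∀ i, P (L i)) →
      ∀ k, P (fam hp1 hpn A H L k) := by
    intro P h1 h2 h3 k
    unfold fam
    split_ifs
    · exact h1 _
    · exact h2
    · exact h3 _
  rcases Nat.eq_zero_or_pos (p - 1) with h0 | hm
  · have : IsEmpty (Fin (p - 1)) := by rw [h0]; infer_instance
    rw [Finset.univ_eq_empty, Finset.prod_empty, h0, pow_zero]
  have hmn : p - 1 ≤ n := by omega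
  refine le_trans (le_of_eq ?_) (AFI.body_ineq hm hmn (fam hp1 hpn A H L) (key _ hAne hHne hLne)
    (key _ hAc hHc hLc) (key _ hAcv hHcv hLcv))
  refine Finset.prod_congr rfl fun i _ => ?_
  congr 1
  ext1 k
  unfold AFI.rep
  by_cases hk : (k : ℕ) < p - 1
  · rw [if_pos hk]
    simp [fam, hk]
  · rw [if_neg hk]
    simp [fam, hk]
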